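/- arXiv:2502.09576 — 3 statements merged into one kernel-verified Lean document; each statement's English description precedes it below -/
import Mathlib

section
/- Corollary 5.2: For every integer k ≥ 5535 and every ε > 0, there exist a constant C = C(k,ε) and n_0 such that the following holds for all n ≥ n_0. If G is an n-vertex maximal C_{2k−1}-free graph with minimum degree δ(G) ≥ (1/(2k−1) + ε)·n, then there exists a set T of at most C vertices such that the chromatic number of the induced subgraph G − T is at most 3. -/
open SimpleGraph

/-- `G` contains a cycle of length `ℓ`. -/
def HasCycleOfLength {V : Type*} (G : SimpleGraph V) (ℓ : ℕ) : Prop :=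
  ∃ (v : V) (w : G.Walk v v), w.IsCycle ∧ w.length = ℓ

/-- `G` is maximal `C_ℓ`-free: it has no cycle of length `ℓ`, and adding any edge
between two non-adjacent vertices creates a cycle of length `ℓ`. -/
def MaximalCLFree {V : Type*} (G : SimpleGraph V) (ℓ : ℕ) : Prop :=
  ¬ HasCycleOfLength G ℓ ∧
    ∀ u v : V, u ≠ v → ¬ G.Adj u v →
      HasCycleOfLength (G ⊔ SimpleGraph.fromEdgeSet {s(u, v)}) ℓ

namespace SimpleGraph

variable {V : Type*}

/-- Every closed walk of odd length has length at least `2 * m + 1`. -/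
def OddGirthGE (G : SimpleGraph V) (m : ℕ) : Prop :=
  ∀ (v : V) (w : G.Walk v v), Odd w.length → 2 * m + 1 ≤ w.length

/-- No vertex has three distinct neighbours in `Y`. -/
def Thin (G : SimpleGraph V) (Y : Set V) : Prop :=
  ∀ c, ∀ a ∈ Y, ∀ b ∈ Y, ∀ d ∈ Y, G.Adj c a → G.Adj c b → G.Adj c d → a = b ∨ a = d ∨ b = d

/-- The graph on the same vertex set keeping only the edges inside `S`. -/
def restrictTo (G : SimpleGraph V) (S : Set V) : SimpleGraph V where
  Adj a b := G.Adj a b ∧ a ∈ S ∧ b ∈ S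
  symm := ⟨fun _ _ h => ⟨h.1.symm, h.2.2, h.2.1⟩⟩
  loopless := ⟨fun _ h => G.loopless.irrefl _ h.1⟩

lemma restrictTo_le (G : SimpleGraph V) (S : Set V) : G.restrictTo S ≤ G := fun _ _ h => h.1

lemma restrictTo_mono (G : SimpleGraph V) {S T : Set V} (h : S ⊆ T) :
    G.restrictTo S ≤ G.restrictTo T := fun _ _ hab => ⟨hab.1, h hab.2.1, h hab.2.2⟩

lemma OddGirthGE.anti {G H : SimpleGraph V} {m : ℕ} (h : G.OddGirthGE m) (hle : H ≤ G) :
    H.OddGirthGE m := fun v w hw => by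
  simpa using h v (w.mapLe hle) (by simpa using hw)

lemma OddGirthGE.mono {G : SimpleGraph V} {m n : ℕ} (h : G.OddGirthGE m) (hle : n ≤ m) :
    G.OddGirthGE n := fun v w hw => by have := h v w hw; omega

lemma Thin.mono {G : SimpleGraph V} {Y Z : Set V} (h : G.Thin Z) (hYZ : Y ⊆ Z) : G.Thin Y :=
  fun c a ha b hb d hd => h c a (hYZ ha) b (hYZ hb) d (hYZ hd)

/-- A thin set in `G.restrictTo S` all of whose `G`-neighbours lie in `S` is thin in `G`. -/
lemma Thin.of_restrictTo {G : SimpleGraph V} {S Y : Set V} (h : (G.restrictTo S).Thin Y)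
    (hY : Y ⊆ S) (hN : ∀ y ∈ Y, ∀ c, G.Adj c y → c ∈ S) : G.Thin Y :=
  fun c a ha b hb d hd hca hcb hcd =>
    h c a ha b hb d hd ⟨hca, hN a ha c hca, hY ha⟩ ⟨hcb, hN b hb c hcb, hY hb⟩
      ⟨hcd, hN d hd c hcd, hY hd⟩

lemma Walk.support_restrictTo {G : SimpleGraph V} {S : Set V} {a b : V}
    (p : (G.restrictTo S).Walk a b) (hp : 0 < p.length) : ∀ y ∈ p.support, y ∈ S := by
  induction p with
  | nil => simp at hp
  | cons h p ih =>
    intro y hy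
    rw [Walk.support_cons, List.mem_cons] at hy
    rcases hy with rfl | hy
    · exact h.2.1
    · cases p with
      | nil => simp at hy; subst hy; exact h.2.2
      | cons h' p => exact ih (by simp) y hy

/-- An edge inside a distance level closes an odd walk. -/
lemma OddGirthGE.le_dist_of_adj {H : SimpleGraph V} {m : ℕ} (hH : H.OddGirthGE m) {x a b : V}
    (ha : H.Reachable x a) (hab : H.Adj a b) (hd : H.dist x a = H.dist x b) :
    m ≤ H.dist x a := by
  obtain ⟨p, hp⟩ := ha.exists_walk_length_eq_dist
  obtain ⟨q, hq⟩ := (ha.trans hab.reachable).exists_walk_length_eq_dist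
  have := hH x (p.append (Walk.cons hab q.reverse))
    (by simp [hp, hq, hd])
  simp [hp, hq] at this
  omega

lemma OddGirthGE.length_parity {H : SimpleGraph V} {m : ℕ} (hH : H.OddGirthGE m) {x a b : V}
    (p : H.Walk a b) (ha : H.Reachable x a) (hp : ∀ y ∈ p.support, H.dist x y < m) :
    p.length % 2 = (H.dist x a + H.dist x b) % 2 := by
  induction p with
  | nil => simp; omega
  | cons h p ih =>
    have h1 := ih (ha.trans h.reachable) (fun y hy => hp y (by simp [hy]))
    have h2 := h.diff_dist_adj (u := x)
    have h3 := fun e => hH.le_dist_of_adj ha h e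
    have h4 := hp _ (Walk.start_mem_support _)
    rw [Walk.length_cons]
    rcases h2 with h2 | h2 | h2 <;> omega

/-- An odd closed walk reaches distance `m` from every vertex of its component. -/
lemma OddGirthGE.exists_far {H : SimpleGraph V} {m : ℕ} (hH : H.OddGirthGE m) {x a : V}
    (w : H.Walk a a) (hw : Odd w.length) (ha : H.Reachable x a) :
    ∃ y ∈ w.support, m ≤ H.dist x y := by
  by_contra! h
  have := hH.length_parity w ha h
  obtain ⟨t, ht⟩ := hw
  omega

/-- Distances from `x` take all intermediate values along a walk. -/
lemma Walk.exists_dist_eq {H : SimpleGraph V} (x : V) {a b : V} (p : H.Walk a b) {j : ℕ}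
    (ha : H.dist x a ≤ j) (hb : j ≤ H.dist x b) : ∃ y ∈ p.support, H.dist x y = j := by
  induction p with
  | nil => exact ⟨_, by simp, le_antisymm ha hb⟩
  | @cons a c b h p ih =>
    rcases ha.eq_or_lt with e | lt
    · exact ⟨a, by simp, e⟩
    · have h2 := h.diff_dist_adj (u := x)
      obtain ⟨y, hy, e⟩ := ih (by omega) hb
      exact ⟨y, by simp [hy], e⟩

/-- A set meeting each of the first `m` distance levels at most once is thin. -/
lemma OddGirthGE.thin_of_injOn_dist {H : SimpleGraph V} {m : ℕ} (hH : H.OddGirthGE m) {x : V}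
    {Y : Set V} (hr : ∀ y ∈ Y, H.Reachable x y) (hm : ∀ y ∈ Y, H.dist x y ≤ m)
    (hinj : Set.InjOn (H.dist x) Y) : H.Thin Y := by
  intro c a ha b hb d hd hca hcb hcd
  have hc : H.Reachable x c := (hr a ha).trans hca.symm.reachable
  have a1 := hca.diff_dist_adj (u := x)
  have b1 := hcb.diff_dist_adj (u := x)
  have d1 := hcd.diff_dist_adj (u := x)
  have a2 := hm a ha
  have b2 := hm b hb
  have d2 := hm d hd
  have a3 := fun e => hH.le_dist_of_adj hc hca e
  have b3 := fun e => hH.le_dist_of_adj hc hcb e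
  have d3 := fun e => hH.le_dist_of_adj hc hcd e
  by_contra! hne
  have e1 : H.dist x a ≠ H.dist x b := fun e => hne.1 (hinj ha hb e)
  have e2 : H.dist x a ≠ H.dist x d := fun e => hne.2.1 (hinj ha hd e)
  have e3 : H.dist x b ≠ H.dist x d := fun e => hne.2.2 (hinj hb hd e)
  by_cases ea : H.dist x c = H.dist x a
  · have := a3 ea; omega
  by_cases eb : H.dist x c = H.dist x b
  · have := b3 eb; omega
  by_cases ed : H.dist x c = H.dist x d
  · have := d3 ed; omega
  omega

section Cyclic

variable {H H' : SimpleGraph V} {m : ℕ} {x : ℤ → V}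

/-- A closed walk of length `2 * m + 1`, read as a periodic sequence. -/
lemma Walk.exists_periodic {v : V} (w : H.Walk v v) (hw : w.length = 2 * m + 1) :
    ∃ x : ℤ → V, (∀ i, x (i + (2 * m + 1)) = x i) ∧
      ∀ i, H.Adj (x i) (x (i + 1)) := by
  refine ⟨fun i => w.getVert (i % (2 * m + 1)).toNat, fun i => by simp, fun i => ?_⟩
  have h0 := Int.emod_nonneg i (b := 2 * m + 1) (by omega)
  have h1 := Int.emod_lt_of_pos i (b := 2 * m + 1) (by omega)
  have h2 := w.adj_getVert_succ (i := (i % (2 * m + 1)).toNat) (by omega)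
  beta_reduce
  have h3 : (i + 1) % (2 * m + 1 : ℤ) = (i % (2 * m + 1) + 1) % (2 * m + 1) := by simp
  rcases (show i % (2 * m + 1 : ℤ) + 1 < 2 * m + 1 ∨ i % (2 * m + 1 : ℤ) = 2 * m by omega) with h | h
  · rw [Int.emod_eq_of_lt (by omega) h] at h3
    rw [h3]
    convert h2 using 2
    omega
  · rw [h] at h3 h2 ⊢
    rw [h3, Int.emod_self]
    rw [w.getVert_of_length_le (i := (2 * m : ℤ).toNat + 1) (by omega)] at h2
    simpa using h2

lemma exists_walk_of_adj_succ (hadj : ∀ i, H.Adj (x i) (x (i + 1))) (i : ℤ) (n : ℕ) :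
    ∃ q : H.Walk (x i) (x (i + n)), q.length = n := by
  induction n with
  | zero => exact ⟨Walk.nil.copy rfl (by simp), by simp⟩
  | succ n ih =>
    obtain ⟨q, hq⟩ := ih
    exact ⟨(q.concat (hadj _)).copy rfl (by push_cast; ring_nf), by simp [hq]⟩

/-- Walks between vertices of a shortest odd closed walk are no shorter than its arcs. -/
lemma OddGirthGE.arc_le_length (hH : H.OddGirthGE m)
    (hper : ∀ i, x (i + (2 * m + 1)) = x i) (hadj : ∀ i, H.Adj (x i) (x (i + 1)))
    {i j : ℤ} (hij : i ≤ j) (hji : j ≤ i + (2 * m + 1)) (p : H.Walk (x i) (x j)) :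
    (p.length % 2 = (j - i) % 2 ∧ j - i ≤ p.length) ∨
      (p.length % 2 ≠ (j - i) % 2 ∧ 2 * m + 1 - (j - i) ≤ p.length) := by
  by_cases hpar : (p.length : ℤ) % 2 = (j - i) % 2
  · left
    refine ⟨hpar, ?_⟩
    obtain ⟨q, hq⟩ := exists_walk_of_adj_succ hadj j (2 * m + 1 - (j - i)).toNat
    have e : x (j + (2 * m + 1 - (j - i)).toNat) = x i := by
      rw [← hper i]; congr 1; omega
    have := hH _ (p.append (q.copy rfl e)) (by
      rw [Nat.odd_iff]; simp [hq]; omega)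
    simp [hq] at this
    omega
  · right
    refine ⟨hpar, ?_⟩
    obtain ⟨q, hq⟩ := exists_walk_of_adj_succ hadj i (j - i).toNat
    have e : x (i + (j - i).toNat) = x j := by congr 1; omega
    have := hH _ (p.append (q.copy rfl e).reverse) (by
      rw [Nat.odd_iff]; simp [hq]; omega)
    simp [hq] at this
    omega

lemma OddGirthGE.periodic_injOn (hH : H.OddGirthGE m)
    (hper : ∀ i, x (i + (2 * m + 1)) = x i) (hadj : ∀ i, H.Adj (x i) (x (i + 1)))
    {i j : ℤ} (hij : i ≤ j) (hji : j ≤ i + 2 * m) (h : x i = x j) : i = j := by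
  have := hH.arc_le_length hper hadj hij (by omega) (Walk.nil.copy rfl h)
  simp at this
  omega

lemma periodic_mem_window (hper : ∀ i, x (i + (2 * m + 1)) = x i) (a i : ℤ) :
    ∃ j, a ≤ j ∧ j ≤ a + 2 * m ∧ x j = x i := by
  have key : ∀ (n : ℕ) (i : ℤ), x (i + n * (2 * m + 1)) = x i := by
    intro n
    induction n with
    | zero => simp
    | succ n ih =>
      intro i
      rw [← ih i, ← hper (i + n * (2 * m + 1))]; congr 1; push_cast; ring
  have h0 := Int.emod_nonneg (i - a) (b := 2 * m + 1) (by omega)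
  have h1 := Int.emod_lt_of_pos (i - a) (b := 2 * m + 1) (by omega)
  have h2 := Int.emod_add_mul_ediv (i - a) (2 * m + 1)
  refine ⟨a + (i - a) % (2 * m + 1), by omega, by omega, ?_⟩
  obtain ⟨n, hn | hn⟩ := Int.eq_nat_or_neg ((i - a) / (2 * m + 1))
  · rw [hn] at h2
    rw [← key n]; congr 1; linarith
  · rw [hn] at h2
    rw [← key n i]; congr 1; linarith

/-- The vertices of a shortest odd closed walk form a thin set. -/
lemma OddGirthGE.thin_range (hH : H.OddGirthGE m) (hm : 2 ≤ m)
    (hper : ∀ i, x (i + (2 * m + 1)) = x i) (hadj : ∀ i, H.Adj (x i) (x (i + 1))) :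
    H.Thin (Set.range x) := by
  have key : ∀ c (i j : ℤ), 0 ≤ i → j ≤ 2 * m → i < j → H.Adj c (x i) → H.Adj c (x j) →
      j - i = 2 ∨ j - i = 2 * m - 1 := by
    intro c i j h0 h1 h2 h3 h4
    have := hH.arc_le_length hper hadj h2.le (by omega) (Walk.cons h3.symm (Walk.cons h4 Walk.nil))
    simp at this
    omega
  rintro c _ ⟨a, rfl⟩ _ ⟨b, rfl⟩ _ ⟨d, rfl⟩ ha hb hd
  obtain ⟨a', a1, a2, a3⟩ := periodic_mem_window hper 0 a
  obtain ⟨b', b1, b2, b3⟩ := periodic_mem_window hper 0 b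
  obtain ⟨d', d1, d2, d3⟩ := periodic_mem_window hper 0 d
  rw [← a3] at ha ⊢; rw [← b3] at hb ⊢; rw [← d3] at hd ⊢
  by_contra! hne
  have e1 : a' ≠ b' := fun e => hne.1 (by rw [e])
  have e2 : a' ≠ d' := fun e => hne.2.1 (by rw [e])
  have e3 : b' ≠ d' := fun e => hne.2.2 (by rw [e])
  have k1 := fun h => key c a' b' a1 (by omega) h ha hb
  have k2 := fun h => key c b' a' b1 (by omega) h hb ha
  have k3 := fun h => key c a' d' a1 (by omega) h ha hd
  have k4 := fun h => key c d' a' d1 (by omega) h hd ha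
  have k5 := fun h => key c b' d' b1 (by omega) h hb hd
  have k6 := fun h => key c d' b' d1 (by omega) h hd hb
  omega

end Cyclic

lemma Thin.union {G : SimpleGraph V} {A B : Set V} (hA : G.Thin A) (hB : G.Thin B)
    (hAB : ∀ a ∈ A, ∀ b ∈ B, 3 ≤ G.dist a b) : G.Thin (A ∪ B) := by
  have key : ∀ c, ∀ a ∈ A, ∀ b ∈ B, G.Adj c a → G.Adj c b → False := by
    intro c a ha b hb h1 h2
    have h3 := hAB a ha b hb
    have h4 := dist_le (Walk.cons h1.symm (Walk.cons h2 Walk.nil))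
    simp at h4
    omega
  intro c a ha b hb d hd hca hcb hcd
  rcases ha with ha | ha <;> rcases hb with hb | hb <;> rcases hd with hd | hd <;>
    first
    | exact hA c a ha b hb d hd hca hcb hcd
    | exact hB c a ha b hb d hd hca hcb hcd
    | (exfalso; first
        | exact key c _ ha _ hb hca hcb
        | exact key c _ hb _ ha hcb hca
        | exact key c _ ha _ hd hca hcd
        | exact key c _ hd _ ha hcd hca)

/-- If `G` is not 3-colorable, it has an odd closed walk far from any given vertex. -/
lemma OddGirthGE.exists_odd_walk_far {G : SimpleGraph V} {k : ℕ} (hG : G.OddGirthGE k)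
    (hc : G.Connected) (hk : 1 ≤ k) (h3 : ¬ G.Colorable 3) (u : V) :
    ∃ (v : V) (w : (G.restrictTo {x | k ≤ G.dist u x}).Walk v v), Odd w.length := by
  by_contra! hno
  apply h3
  obtain ⟨c⟩ : (G.restrictTo {x | k ≤ G.dist u x}).Colorable 2 :=
    two_colorable_iff_forall_loop_even.2 fun v w => by simpa using hno v w
  refine (colorable_iff_exists_bdd_nat_coloring 3).2 ⟨Coloring.mk (fun x =>
    if G.dist u x < k - 1 then G.dist u x % 2 else if G.dist u x = k - 1 then 2 else c x) ?_, ?_⟩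
  · intro a b hab
    have h1 := hab.diff_dist_adj (u := u)
    have h2 := fun e => hG.le_dist_of_adj (hc u a) hab e
    have hca := (c a).2
    have hcb := (c b).2
    have h4 : k ≤ G.dist u a → k ≤ G.dist u b → (c a : ℕ) ≠ c b := fun p q e =>
      c.valid (v := a) (w := b) ⟨hab, p, q⟩ (Fin.ext e)
    split_ifs <;> omega
  · intro x
    have := (c x).2
    simp only [Coloring.mk, RelHom.coeFn_mk]
    split_ifs <;> omega

section FarThin

variable {G : SimpleGraph V} {k : ℕ}

lemma OddGirthGE.exists_far_thin (hG : G.OddGirthGE k) (hc : G.Connected) (hk : 108 ≤ k)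
    (h3 : ¬ G.Colorable 3) (u : V) :
    ∃ R ≤ k, ∃ Y : Finset V, G.Thin (Y : Set V) ∧ (∀ y ∈ Y, R ≤ G.dist u y) ∧
      4 * k + 28 ≤ 3 * R + Y.card := by
  classical
  let S : ℕ → Set V := fun r => {x | r ≤ G.dist u x}
  have hS : ∀ {r s}, r ≤ s → S s ⊆ S r := fun h x hx => le_trans h hx
  let P : ℕ → Set ℕ := fun r => {m | ∃ (v : V) (w : (G.restrictTo (S r)).Walk v v),
    w.length = 2 * m + 1}
  have hPmono : ∀ {r s}, r ≤ s → P s ⊆ P r := by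
    rintro r s h m ⟨v, w, hw⟩
    exact ⟨v, w.mapLe (G.restrictTo_mono (hS h)), by simpa using hw⟩
  have hPk : (P k).Nonempty := by
    obtain ⟨v, w, m, hm⟩ := hG.exists_odd_walk_far hc (by omega) h3 u
    exact ⟨m, v, w, hm⟩
  have hP : ∀ r ≤ k, (P r).Nonempty := fun r hr => hPk.mono (hPmono hr)
  let g : ℕ → ℕ := fun r => sInf (P r)
  have hgmem : ∀ r ≤ k, g r ∈ P r := fun r hr => Nat.sInf_mem (hP r hr)
  have hgle : ∀ r m, m ∈ P r → g r ≤ m := fun r m h => Nat.sInf_le h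
  have hgk : ∀ r ≤ k, k ≤ g r := by
    intro r hr
    obtain ⟨v, w, hw⟩ := hgmem r hr
    have := hG.anti (G.restrictTo_le (S r)) v w (hw ▸ by simp)
    omega
  have hgirth : ∀ r, (G.restrictTo (S r)).OddGirthGE (g r) := by
    rintro r v w ⟨m, hm⟩
    have := hgle r m ⟨v, w, hm⟩
    omega
  have hnbr : ∀ {r : ℕ} {y c : V}, r + 1 ≤ G.dist u y → G.Adj c y → r ≤ G.dist u c := by
    intro r y c h1 h2
    have := h2.diff_dist_adj (u := u)
    omega
  by_cases hstep : ∃ r, k - 28 ≤ r ∧ r ≤ k - 2 ∧ g r = g (r + 1)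
  · obtain ⟨r, hr1, hr2, hr⟩ := hstep
    obtain ⟨v, w, hw⟩ := hgmem (r + 1) (by omega)
    rw [← hr] at hw
    obtain ⟨x, hper, hadj⟩ := w.exists_periodic hw
    have hadj' : ∀ i, (G.restrictTo (S r)).Adj (x i) (x (i + 1)) :=
      fun i => G.restrictTo_mono (hS (Nat.le_succ r)) (hadj i)
    have hxd : ∀ i, r + 1 ≤ G.dist u (x i) := fun i => (hadj i).2.1
    have hth := (hgirth r).thin_range (by have := hgk r (by omega); omega) hper hadj'
    refine ⟨r + 1, by omega, (Finset.Icc (0 : ℤ) (2 * g r)).image x, ?_, ?_, ?_⟩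
    · refine (hth.of_restrictTo ?_ ?_).mono (by simp)
      · rintro _ ⟨i, rfl⟩
        exact (Nat.le_succ r).trans (hxd i)
      · rintro _ ⟨i, rfl⟩ c hcx
        exact hnbr (hxd i) hcx
    · intro y hy
      obtain ⟨i, -, rfl⟩ := Finset.mem_image.1 hy
      exact hxd i
    · rw [Finset.card_image_of_injOn]
      · have := hgk r (by omega)
        simp
        omega
      · intro i hi j hj e
        simp only [Finset.coe_Icc, Set.mem_Icc] at hi hj
        rcases le_total i j with h | h
        · exact (hgirth r).periodic_injOn hper hadj' h (by omega) e
        · exact ((hgirth r).periodic_injOn hper hadj' h (by omega) e.symm).symm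
  · push Not at hstep
    have hlt : ∀ n ≤ 27, k + n ≤ g (k - 28 + n) := by
      intro n hn
      induction n with
      | zero => exact hgk _ (by omega)
      | succ n ih =>
        have h1 := hstep (k - 28 + n) (by omega) (by omega)
        have h2 := hgle (k - 28 + n) _ (hPmono (Nat.le_succ _) (hgmem (k - 28 + n + 1) (by omega)))
        have := ih (by omega)
        rw [show k - 28 + (n + 1) = k - 28 + n + 1 from rfl]
        omega
    have hgirth' : (G.restrictTo (S (k - 1))).OddGirthGE (k + 27) :=
      (hgirth (k - 1)).mono (by have := hlt 27 le_rfl; rwa [show k - 28 + 27 = k - 1 by omega] at this)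
    obtain ⟨v, w, hw⟩ := hgmem k le_rfl
    have hle := G.restrictTo_mono (hS (Nat.sub_le k 1))
    have hsupp : ∀ y ∈ (w.mapLe hle).support, k ≤ G.dist u y := by
      intro y hy
      exact w.support_restrictTo (by omega) y (by simpa using hy)
    have hreach : ∀ y ∈ (w.mapLe hle).support, (G.restrictTo (S (k - 1))).Reachable v y :=
      fun y hy => ⟨(w.mapLe hle).takeUntil y hy⟩
    obtain ⟨z, hz, hzd⟩ := hgirth'.exists_far (x := v) (w.mapLe hle) (by simp [hw]) (.refl v)
    have hlev : ∀ j : ℕ, ∃ y, j ≤ k + 27 →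
        y ∈ (w.mapLe hle).support ∧ (G.restrictTo (S (k - 1))).dist v y = j := by
      intro j
      by_cases hj : j ≤ k + 27
      · obtain ⟨y, hy, e⟩ := ((w.mapLe hle).takeUntil z hz).exists_dist_eq v
          (j := j) (by simp) (by omega)
        exact ⟨y, fun _ => ⟨(w.mapLe hle).support_takeUntil_subset_support hz hy, e⟩⟩
      · exact ⟨v, fun h => absurd h hj⟩
    choose y hy using hlev
    have hyI : ∀ a ∈ (Finset.range (k + 28)).image y, ∃ j ≤ k + 27, y j = a := by
      intro a ha
      obtain ⟨j, hj, rfl⟩ := Finset.mem_image.1 ha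
      exact ⟨j, by simp at hj; omega, rfl⟩
    refine ⟨k, le_rfl, (Finset.range (k + 28)).image y, ?_, ?_, ?_⟩
    · refine Thin.of_restrictTo (S := S (k - 1)) (hgirth'.thin_of_injOn_dist (x := v) ?_ ?_ ?_) ?_ ?_
      · intro a ha
        obtain ⟨j, hj, rfl⟩ := hyI a ha
        exact hreach _ (hy j hj).1
      · intro a ha
        obtain ⟨j, hj, rfl⟩ := hyI a ha
        rw [(hy j hj).2]; exact hj
      · intro a ha b hb e
        obtain ⟨i, hi, rfl⟩ := hyI a ha
        obtain ⟨j, hj, rfl⟩ := hyI b hb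
        rw [(hy j hj).2, (hy i hi).2] at e
        rw [e]
      · intro a ha
        obtain ⟨j, hj, rfl⟩ := hyI a ha
        exact (Nat.sub_le k 1).trans (hsupp _ (hy j hj).1)
      · intro a ha c hca
        obtain ⟨j, hj, rfl⟩ := hyI a ha
        exact hnbr (by have := hsupp _ (hy j hj).1; omega) hca
    · intro a ha
      obtain ⟨j, hj, rfl⟩ := hyI a ha
      exact hsupp _ (hy j hj).1
    · rw [Finset.card_image_of_injOn]
      · simp; omega
      · intro i hi j hj e
        simp at hi hj
        rw [← (hy i (by omega)).2, ← (hy j (by omega)).2, e]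

end FarThin

lemma dist_periodic_le {G : SimpleGraph V} {x : ℤ → V} (hadj : ∀ i, G.Adj (x i) (x (i + 1)))
    {i j : ℤ} (hij : i ≤ j) : (G.dist (x i) (x j) : ℤ) ≤ j - i := by
  obtain ⟨q, hq⟩ := exists_walk_of_adj_succ hadj i (j - i).toNat
  have := dist_le q
  rw [hq, show i + ((j - i).toNat : ℤ) = j by omega] at this
  omega

/-- A connected graph whose shortest odd cycle has length `2 * k + 1` and in which every thin set
is small is 3-colorable. -/
lemma OddGirthGE.colorable_three_of_walk {G : SimpleGraph V} {k : ℕ} (hG : G.OddGirthGE k)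
    (hc : G.Connected) (hk : 108 ≤ k) {v₀ : V} (w₀ : G.Walk v₀ v₀) (hw₀ : w₀.length = 2 * k + 1)
    (hthin : ∀ Y : Finset V, G.Thin (Y : Set V) → Y.card < 4 * k + 6) : G.Colorable 3 := by
  classical
  by_contra h3
  obtain ⟨x, hper, hadj⟩ := w₀.exists_periodic hw₀
  obtain ⟨d₀, D', hD'⟩ := hG.exists_odd_walk_far hc (by omega) h3 (x 0)
  have hle := G.restrictTo_le {y | k ≤ G.dist (x 0) y}
  let D := D'.mapLe hle
  have hDodd : Odd D.length := by simpa [D] using hD'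
  have hDfar : ∀ y ∈ D.support, k ≤ G.dist (x 0) y := fun y hy =>
    D'.support_restrictTo hD'.pos y (by simpa [D] using hy)
  have hex : ∃ n, ∃ i, ∃ y ∈ D.support, G.dist (x i) y = n :=
    ⟨_, 0, d₀, D.start_mem_support, rfl⟩
  obtain ⟨i₀, y, hyD, hmin₀⟩ := Nat.find_spec hex
  obtain ⟨m, hm0, hm1, hm⟩ := periodic_mem_window hper 0 i₀
  have hmin : ∀ i, ∀ z ∈ D.support, G.dist (x m) y ≤ G.dist (x i) z := by
    intro i z hz
    rw [hm, hmin₀]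
    exact Nat.find_min' hex ⟨i, z, hz, rfl⟩
  obtain ⟨Q, hQ⟩ := hc.exists_walk_length_eq_dist (x m) y
  obtain ⟨p, hpD, hp⟩ := hG.exists_far (x := x m) D hDodd (hc _ _)
  have hQsplit : ∀ e ∈ Q.support, G.dist (x m) e + G.dist e y ≤ G.dist (x m) y := by
    intro e he
    rw [← hQ, ← Q.take_spec he, Walk.length_append]
    exact add_le_add (dist_le _) (dist_le _)
  have hlev : ∀ j : ℕ, ∃ e, j ≤ k → (e ∈ Q.support ∨ e ∈ D.support) ∧ G.dist (x m) e = j := by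
    intro j
    by_cases hj : j ≤ k
    · obtain ⟨e, he, hej⟩ := (Q.append ((D.takeUntil y hyD).reverse.append
        (D.takeUntil p hpD))).exists_dist_eq (x m) (j := j) (by simp) (by omega)
      refine ⟨e, fun _ => ⟨?_, hej⟩⟩
      simp only [Walk.mem_support_append_iff, Walk.support_reverse, List.mem_reverse] at he
      rcases he with he | he | he
      · exact .inl he
      · exact .inr (D.support_takeUntil_subset_support hyD he)
      · exact .inr (D.support_takeUntil_subset_support hpD he)
    · exact ⟨x 0, fun h => absurd h hj⟩
  choose e he using hlev
  obtain ⟨R, hRk, Y, hYthin, hYfar, hYcard⟩ := hG.exists_far_thin hc hk h3 (x m)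
  have hYlt := hthin Y hYthin
  have hinj : ∀ i j : ℤ, m - (R - 3) ≤ i → i ≤ m + (R - 3) → m - (R - 3) ≤ j → j ≤ m + (R - 3) →
      x i = x j → i = j := by
    intro i j h1 h2 h3 h4 h
    rcases le_total i j with h' | h'
    · exact hG.periodic_injOn hper hadj h' (by omega) h
    · exact (hG.periodic_injOn hper hadj h' (by omega) h.symm).symm
  let I := Finset.Icc (m - (R - 3)) (m + (R - 3)) \ Finset.Icc ((k : ℤ) - 2) (k + 3)
  have hI : ∀ i ∈ I, m - (R - 3) ≤ i ∧ i ≤ m + (R - 3) ∧ G.dist (x 0) (x i) + 3 ≤ k ∧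
      G.dist (x m) (x i) + 3 ≤ R := by
    intro i hi
    simp only [I, Finset.mem_sdiff, Finset.mem_Icc] at hi
    refine ⟨hi.1.1, hi.1.2, ?_, ?_⟩
    · rcases le_total i 0 with h | h
      · have := dist_periodic_le hadj h
        rw [dist_comm] at this; omega
      · have h1 := dist_periodic_le hadj h
        rcases le_total i (2 * k + 1) with h' | h'
        · have h2 := dist_periodic_le hadj h'
          have h4 := hper 0
          rw [zero_add] at h4
          rw [h4, dist_comm] at h2
          omega
        · have h2 := dist_periodic_le hadj h'
          have h4 := hper 0
          rw [zero_add] at h4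
          rw [h4] at h2
          omega
    · rcases le_total i m with h | h
      · have := dist_periodic_le hadj h
        rw [dist_comm] at this; omega
      · have := dist_periodic_le hadj h
        omega
  have hIcard : 2 * R ≤ I.card + 11 := by
    have h1 := Finset.le_card_sdiff (Finset.Icc ((k : ℤ) - 2) (k + 3))
      (Finset.Icc (m - (R - 3)) (m + (R - 3)))
    simp only [Int.card_Icc] at h1
    change _ ≤ I.card at h1
    omega
  let C := I.image x
  let E := (Finset.Icc 3 (R - 3)).image e
  have hCthin : G.Thin (C : Set V) := (hG.thin_range (by omega) hper hadj).mono (by simp [C])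
  have hEmem : ∀ a ∈ E, ∃ j, 3 ≤ j ∧ j + 3 ≤ R ∧ e j = a := by
    intro a ha
    obtain ⟨j, hj, rfl⟩ := Finset.mem_image.1 ha
    rw [Finset.mem_Icc] at hj
    exact ⟨j, hj.1, by omega, rfl⟩
  have hEthin : G.Thin (E : Set V) := by
    refine hG.thin_of_injOn_dist (x := x m) (fun _ _ => hc _ _) ?_ ?_
    · intro a ha
      obtain ⟨j, h1, h2, rfl⟩ := hEmem a ha
      rw [(he j (by omega)).2]; omega
    · intro a ha b hb hab
      obtain ⟨i, h1, h2, rfl⟩ := hEmem a ha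
      obtain ⟨j, h3, h4, rfl⟩ := hEmem b hb
      rw [(he j (by omega)).2, (he i (by omega)).2] at hab
      rw [hab]
  have hCE : ∀ a ∈ C, ∀ b ∈ E, 3 ≤ G.dist a b := by
    intro a ha b hb
    obtain ⟨i, hi, rfl⟩ := Finset.mem_image.1 ha
    obtain ⟨j, h3, h4, rfl⟩ := hEmem b hb
    obtain ⟨h1, h2⟩ := he j (by omega)
    obtain ⟨-, -, h5, -⟩ := hI i hi
    rcases h1 with h1 | h1
    · have := hQsplit _ h1
      have := hmin i y hyD
      have := hc.dist_triangle (u := x i) (v := e j) (w := y)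
      omega
    · have := hDfar _ h1
      have := hc.dist_triangle (u := x 0) (v := x i) (w := e j)
      omega
  have hCEY : ∀ a ∈ C ∪ E, ∀ b ∈ Y, 3 ≤ G.dist a b := by
    intro a ha b hb
    have h1 := hYfar b hb
    have h2 := hc.dist_triangle (u := x m) (v := a) (w := b)
    rcases Finset.mem_union.1 ha with ha | ha
    · obtain ⟨i, hi, rfl⟩ := Finset.mem_image.1 ha
      obtain ⟨-, -, -, h5⟩ := hI i hi
      omega
    · obtain ⟨j, h3, h4, rfl⟩ := hEmem a ha
      have := (he j (by omega)).2
      omega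
  have hdisj : ∀ {A B : Finset V}, (∀ a ∈ A, ∀ b ∈ B, 3 ≤ G.dist a b) → Disjoint A B := by
    intro A B h
    rw [Finset.disjoint_left]
    intro a ha hb
    have := h a ha a hb
    simp at this
  have hZ := hthin ((C ∪ E) ∪ Y) (by
    rw [Finset.coe_union, Finset.coe_union]
    refine (hCthin.union hEthin hCE).union hYthin ?_
    rw [← Finset.coe_union]
    exact hCEY)
  rw [Finset.card_union_of_disjoint (hdisj hCEY), Finset.card_union_of_disjoint (hdisj hCE)] at hZ
  have hCcard : C.card = I.card := Finset.card_image_of_injOn fun i hi j hj hij => by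
    have h1 := hI i hi
    have h2 := hI j hj
    exact hinj i j h1.1 h1.2.1 h2.1 h2.2.1 hij
  have hEcard : E.card = R - 3 + 1 - 3 := by
    rw [← Nat.card_Icc]
    refine Finset.card_image_of_injOn fun i hi j hj hij => ?_
    rw [Finset.coe_Icc, Set.mem_Icc] at hi hj
    rw [← (he i (by omega)).2, ← (he j (by omega)).2, hij]
  omega

/-- A graph of odd girth at least `2 * k + 1` in which every thin set is small is 3-colorable. -/
theorem OddGirthGE.colorable_three {G : SimpleGraph V} {k : ℕ} (hG : G.OddGirthGE k)
    (hk : 108 ≤ k) (hthin : ∀ Y : Finset V, G.Thin (Y : Set V) → Y.card < 4 * k + 6) :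
    G.Colorable 3 := by
  rw [colorable_iff_forall_connectedComponent]
  intro c
  have hcG : c.toSimpleGraph.OddGirthGE k := fun v w hw => by
    simpa using hG _ (w.map c.toSimpleGraph_hom) (by simpa using hw)
  have hcthin : ∀ Y : Finset c, c.toSimpleGraph.Thin (Y : Set c) → Y.card < 4 * k + 6 := by
    intro Y hY
    rw [← Finset.card_map (Function.Embedding.subtype _)]
    refine hthin _ ?_
    intro z a ha b hb d hd hza hzb hzd
    simp only [Finset.coe_map, Set.mem_image, Finset.mem_coe] at ha hb hd
    obtain ⟨a, ha, rfl⟩ := ha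
    obtain ⟨b, hb, rfl⟩ := hb
    obtain ⟨d, hd, rfl⟩ := hd
    have hz : z ∈ c := c.mem_supp_of_adj_mem_supp a.2 hza.symm
    exact (hY ⟨z, hz⟩ a ha b hb d hd hza hzb hzd).imp (congrArg _)
      (Or.imp (congrArg _) (congrArg _))
  by_cases hodd : ∃ n, ∃ (v : c) (w : c.toSimpleGraph.Walk v v), w.length = 2 * n + 1
  · classical
    obtain ⟨v, w, hw⟩ := Nat.find_spec hodd
    have hge : k ≤ Nat.find hodd := by
      have := hcG v w (by simp [hw]); omega
    refine OddGirthGE.colorable_three_of_walk (k := Nat.find hodd) ?_ c.connected_toSimpleGraph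
      (by omega) w hw fun Y hY => (hcthin Y hY).trans_le (by omega)
    rintro v' w' ⟨n, hn⟩
    have := Nat.find_min' hodd ⟨v', w', hn⟩
    omega
  · push Not at hodd
    refine Colorable.mono (n := 2) (by norm_num) (two_colorable_iff_forall_loop_even.2 ?_)
    intro v w
    by_contra h
    obtain ⟨n, hn⟩ := Nat.not_even_iff_odd.1 h
    exact hodd n v w hn

lemma Thin.card_mul_le {G : SimpleGraph V} [Fintype V] {Y : Finset V} (hY : G.Thin (Y : Set V))
    {d : ℕ} (hd : ∀ v, d ≤ (G.neighborSet v).ncard) : Y.card * d ≤ Nat.card V * 2 := by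
  classical
  rw [Nat.card_eq_fintype_card, ← Finset.card_univ]
  refine Finset.card_mul_le_card_mul G.Adj (fun v _ => ?_) (fun c _ => ?_)
  · convert hd v
    rw [← Set.ncard_coe_finset]
    congr 1
    ext; simp
  · by_contra! h
    obtain ⟨a, ha, b, hb, d, hd, h1, h2, h3⟩ := Finset.two_lt_card.1 h
    simp only [Finset.mem_bipartiteBelow] at ha hb hd
    rcases hY c a ha.1 b hb.1 d hd.1 ha.2.symm hb.2.symm hd.2.symm with e | e | e
    exacts [h1 e, h2 e, h3 e]

lemma ncard_neighborSet_le_induce_compl (G : SimpleGraph V) [Finite V] (T : Finset V)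
    (v : ((T : Set V)ᶜ : Set V)) :
    (G.neighborSet v).ncard ≤ ((G.induce (T : Set V)ᶜ).neighborSet v).ncard + T.card := by
  rw [← Set.ncard_image_of_injective _ Subtype.val_injective, ← Set.ncard_coe_finset T]
  refine (Set.ncard_le_ncard ?_ (Set.toFinite _)).trans (Set.ncard_union_le _ _)
  intro c hc
  by_cases h : c ∈ T
  · exact .inr h
  · exact .inl ⟨⟨c, h⟩, hc, rfl⟩

/-- In a graph of linear minimum degree, a positive proportion of any family of vertices has many
common neighbours. -/
lemma exists_subset_card_commonNeighbors [Fintype V] (G : SimpleGraph V) {ι : Type*}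
    (I : Finset ι) (f : ι → V) {k q : ℕ} (hk : 1 ≤ k)
    (hdeg : ∀ v, Nat.card V ≤ 2 * k * (G.neighborSet v).ncard)
    (hn : 4 * k * (2 ^ I.card * q) < Nat.card V) :
    ∃ A ⊆ I, I.card ≤ 4 * k * A.card ∧
      ∃ W : Finset V, q ≤ W.card ∧ ∀ w ∈ W, ∀ i ∈ A, G.Adj w (f i) := by
  classical
  by_contra! hno
  have hno' : ∀ A ⊆ I, I.card ≤ 4 * k * A.card →
      (Finset.univ.filter fun c => ∀ i ∈ A, G.Adj c (f i)).card < q := by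
    intro A hA h
    by_contra! hq
    obtain ⟨w, hw, i, hi, h'⟩ := hno A hA h _ hq
    exact h' ((Finset.mem_filter.1 hw).2 i hi)
  let N : V → Finset ι := fun c => I.filter fun i => G.Adj c (f i)
  let B := Finset.univ.filter fun c => I.card ≤ 4 * k * (N c).card
  have hB : B.card ≤ 2 ^ I.card * q := by
    have hsub : B ⊆ (I.powerset.filter fun A => I.card ≤ 4 * k * A.card).biUnion
        fun A => Finset.univ.filter fun c => ∀ i ∈ A, G.Adj c (f i) := by
      intro c hc
      simp only [Finset.mem_biUnion, Finset.mem_filter, Finset.mem_powerset]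
      exact ⟨N c, ⟨Finset.filter_subset _ _, (Finset.mem_filter.1 hc).2⟩, Finset.mem_univ _,
        fun i hi => (Finset.mem_filter.1 hi).2⟩
    refine (Finset.card_le_card hsub).trans ((Finset.card_biUnion_le_card_mul _ _ q ?_).trans ?_)
    · intro A hA
      simp only [Finset.mem_filter, Finset.mem_powerset] at hA
      exact (hno' A hA.1 hA.2).le
    · gcongr
      exact (Finset.card_filter_le _ _).trans (Finset.card_powerset I).le
  have hsum : ∑ c, (N c).card = ∑ i ∈ I, (G.neighborSet (f i)).ncard := by
    have := Finset.sum_card_bipartiteAbove_eq_sum_card_bipartiteBelow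
      (s := Finset.univ) (t := I) (fun c i => G.Adj c (f i))
    refine this.trans (Finset.sum_congr rfl fun i _ => ?_)
    rw [← Set.ncard_coe_finset]
    congr 1
    ext c
    simp [Finset.bipartiteBelow, adj_comm]
  have hlow : I.card * Nat.card V ≤ 2 * k * ∑ c, (N c).card := by
    rw [hsum, Finset.mul_sum, ← smul_eq_mul]
    exact Finset.card_nsmul_le_sum _ _ _ fun i _ => hdeg _
  have hup : 4 * k * ∑ c, (N c).card ≤ I.card * Nat.card V + B.card * (4 * k * I.card) := by
    have : ∀ c, 4 * k * (N c).card ≤ I.card + if c ∈ B then 4 * k * I.card else 0 := by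
      intro c
      split_ifs with h
      · have : 4 * k * (N c).card ≤ 4 * k * I.card :=
          Nat.mul_le_mul_left _ (Finset.card_filter_le _ _)
        omega
      · have : ¬ (I.card ≤ 4 * k * (N c).card) := fun h' => h (by simp [B, h'])
        omega
    rw [Finset.mul_sum]
    refine (Finset.sum_le_sum fun c _ => this c).trans ?_
    rw [Finset.sum_add_distrib, Finset.sum_ite_mem]
    simp [mul_comm]
  rcases Nat.eq_zero_or_pos I.card with h0 | hpos
  · have hall : B = Finset.univ := by ext; simp [B, h0]
    rw [hall, Finset.card_univ, ← Nat.card_eq_fintype_card] at hB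
    nlinarith
  · have h1 : I.card * Nat.card V ≤ I.card * (4 * k * B.card) := by linarith
    have h2 := Nat.le_of_mul_le_mul_left h1 hpos
    have h3 : 4 * k * B.card ≤ 4 * k * (2 ^ I.card * q) := Nat.mul_le_mul_left _ hB
    omega

section Cycles

variable {G : SimpleGraph V}

lemma Walk.IsPath.hasCycleOfLength {u z w : V} {p : G.Walk u z} (hp : p.IsPath)
    (hpos : 0 < p.length) (hw : w ∉ p.support) (hwu : G.Adj w u) (hzw : G.Adj w z) :
    HasCycleOfLength G (p.length + 2) := by
  refine ⟨w, Walk.cons hwu (p.concat hzw.symm), ?_, by simp⟩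
  rw [Walk.cons_isCycle_iff]
  refine ⟨hp.concat hw _, ?_⟩
  rw [Walk.edges_concat, List.concat_eq_append, List.mem_append, not_or]
  refine ⟨fun h => hw (p.fst_mem_support_of_mem_edges h), fun h => ?_⟩
  have huz : u = z := by
    rw [List.mem_singleton, Sym2.eq_iff] at h
    rcases h with h | h
    · exact absurd h.1 hzw.ne
    · exact h.2
  subst huz
  exact hpos.ne' (Walk.length_eq_zero_iff.2 (Walk.isPath_iff_nil.1 hp))

lemma Walk.IsPath.exists_extend {u z w z' : V} {p : G.Walk u z} (hp : p.IsPath)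
    (hw : w ∉ p.support) (hz' : z' ∉ p.support) (hwz : G.Adj w z) (hwz' : G.Adj w z') :
    ∃ p' : G.Walk u z', p'.IsPath ∧ p'.length = p.length + 2 ∧
      ∀ y ∈ p'.support, y ∈ p.support ∨ y = w ∨ y = z' := by
  refine ⟨(p.concat hwz.symm).concat hwz', (hp.concat hw _).concat ?_ _, by simp, ?_⟩
  · simp [Walk.support_concat, hz', hwz'.ne']
  · intro y hy
    simpa [Walk.support_concat, or_assoc] using hy

lemma exists_notMem_of_card_lt [DecidableEq V] {W X : Finset V} {l : List V}
    (h : l.length + X.card < W.card) : ∃ w ∈ W, w ∉ l ∧ w ∉ X := by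
  have h1 : (l.toFinset ∪ X).card < W.card :=
    ((Finset.card_union_le _ _).trans (Nat.add_le_add_right l.toFinset_card_le _)).trans_lt h
  obtain ⟨w, hw, hn⟩ := Finset.exists_mem_notMem_of_card_lt_card h1
  simp only [Finset.mem_union, List.mem_toFinset, not_or] at hn
  exact ⟨w, hw, hn⟩

/-- Disjoint odd cycles of the same length, with many common neighbours of corresponding
endpoints, can be combined into longer odd cycles. -/
lemma hasCycleOfLength_of_disjoint_cycles {ι : Type*} (A : Finset ι) (a b : ι → V)
    (S : ι → Finset V) {j m : ℕ} (hm : 2 ≤ m) (hmA : m ≤ A.card)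
    (hdisj : ∀ i ∈ A, ∀ i' ∈ A, i ≠ i' → Disjoint (S i) (S i'))
    (hpath : ∀ i ∈ A, ∃ p : G.Walk (a i) (b i), p.IsPath ∧ p.length = 2 * j ∧
      ∀ y ∈ p.support, y ∈ S i)
    (hab : ∀ i ∈ A, G.Adj (a i) (b i)) (Wa Wb : Finset V)
    (hWa : ∀ w ∈ Wa, ∀ i ∈ A, G.Adj w (a i)) (hWb : ∀ w ∈ Wb, ∀ i ∈ A, G.Adj w (b i))
    (hWacard : 2 * j + 2 * m + A.card < Wa.card) (hWbcard : 2 * j + 2 * m + A.card < Wb.card) :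
    HasCycleOfLength G (2 * j + 1 + 2 * m) := by
  classical
  have haS : ∀ i ∈ A, a i ∈ S i := fun i hi => by
    obtain ⟨p, -, -, h⟩ := hpath i hi
    exact h _ p.start_mem_support
  have hbS : ∀ i ∈ A, b i ∈ S i := fun i hi => by
    obtain ⟨p, -, -, h⟩ := hpath i hi
    exact h _ p.end_mem_support
  have hne : ∀ {i i' y z}, i ∈ A → i' ∈ A → i ≠ i' → y ∈ S i → z ∈ S i' → y ≠ z :=
    fun hi hi' h hy hz e => Finset.disjoint_left.1 (hdisj _ hi _ hi' h) hy (e ▸ hz)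
  obtain ⟨i₁, hi₁, i₂, hi₂, h12⟩ := Finset.one_lt_card.1 (by omega : 1 < A.card)
  have key : ∀ s, s + 2 ≤ m → ∃ U ⊆ A, U.card + s + 2 = A.card ∧ ∃ i ∈ A,
      ∃ p : G.Walk (a i₁) (a i), p.IsPath ∧ p.length = 2 * j + 3 + 2 * s ∧
        ∀ i ∈ U, a i ∉ p.support := by
    intro s hs
    induction s with
    | zero =>
      obtain ⟨p, hp, hpl, hps⟩ := hpath i₁ hi₁
      obtain ⟨w, hw, hwp, hwA⟩ := exists_notMem_of_card_lt (W := Wb) (X := A.image a)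
        (l := p.support) (by
          have := Finset.card_image_le (s := A) (f := a)
          rw [Walk.length_support]; omega)
      have hwA' : ∀ i ∈ A, w ≠ a i := fun i hi e => hwA (Finset.mem_image.2 ⟨i, hi, e.symm⟩)
      obtain ⟨p', hp', hpl', hps'⟩ := hp.exists_extend hwp
        (fun h => hne hi₁ hi₂ h12 (hps _ h) (hbS _ hi₂) rfl) (hWb w hw i₁ hi₁) (hWb w hw i₂ hi₂)
      refine ⟨(A.erase i₁).erase i₂, (Finset.erase_subset _ _).trans (Finset.erase_subset _ _), ?_,
        i₂, hi₂, p'.concat (hab i₂ hi₂).symm, hp'.concat ?_ _, ?_, ?_⟩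
      · rw [Finset.card_erase_of_mem (Finset.mem_erase.2 ⟨h12.symm, hi₂⟩),
          Finset.card_erase_of_mem hi₁]
        omega
      · intro h
        rcases hps' _ h with h | h | h
        · exact hne hi₁ hi₂ h12 (hps _ h) (haS _ hi₂) rfl
        · exact hwA' i₂ hi₂ h.symm
        · exact (hab i₂ hi₂).ne h
      · simp [hpl', hpl]
      · intro i hi h
        simp only [Finset.mem_erase] at hi
        simp only [Walk.support_concat, List.mem_append,
          List.mem_singleton] at h
        rcases h with h | h
        · rcases hps' _ h with h | h | h
          · exact hne hi₁ hi.2.2 (Ne.symm hi.2.1) (hps _ h) (haS _ hi.2.2) rfl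
          · exact hwA' i hi.2.2 h.symm
          · exact hne hi.2.2 hi₂ hi.1 (haS _ hi.2.2) (hbS _ hi₂) h
        · exact hne hi.2.2 hi₂ hi.1 (haS _ hi.2.2) (haS _ hi₂) h
    | succ s ih =>
      obtain ⟨U, hUA, hU, i, hi, p, hp, hpl, hpU⟩ := ih (by omega)
      obtain ⟨i', hi'⟩ := Finset.card_pos.1 (by omega : 0 < U.card)
      obtain ⟨w, hw, hwp, -⟩ := exists_notMem_of_card_lt (W := Wa) (X := ∅)
        (l := p.support) (by rw [Walk.length_support]; simp; omega)
      obtain ⟨p', hp', hpl', hps'⟩ := hp.exists_extend hwp (hpU i' hi') (hWa w hw i hi)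
        (hWa w hw i' (hUA hi'))
      refine ⟨U.erase i', (Finset.erase_subset _ _).trans hUA, ?_, i', hUA hi', p', hp',
        by omega, ?_⟩
      · rw [Finset.card_erase_of_mem hi']; omega
      · intro l hl h
        rw [Finset.mem_erase] at hl
        rcases hps' _ h with h | h | h
        · exact hpU l hl.2 h
        · exact (hWa w hw l (hUA hl.2)).ne h.symm
        · exact hne (hUA hl.2) (hUA hi') hl.1 (haS _ (hUA hl.2)) (haS _ (hUA hi')) h
  obtain ⟨U, hUA, hU, i, hi, p, hp, hpl, hpU⟩ := key (m - 2) (by omega)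
  obtain ⟨w, hw, hwp, -⟩ := exists_notMem_of_card_lt (W := Wa) (X := ∅)
    (l := p.support) (by rw [Walk.length_support]; simp; omega)
  have := hp.hasCycleOfLength (by omega) hwp (hWa w hw i₁ hi₁) (hWa w hw i hi)
  rwa [show p.length + 2 = 2 * j + 1 + 2 * m by omega] at this

end Cycles

lemma exists_path_of_adj_succ {H : SimpleGraph V} {x : ℤ → V}
    (hadj : ∀ i, H.Adj (x i) (x (i + 1))) (n : ℕ) (hinj : Set.InjOn x (Set.Icc 0 n)) :
    ∃ q : H.Walk (x 0) (x n), q.IsPath ∧ q.length = n := by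
  suffices h : ∃ q : H.Walk (x 0) (x n), q.IsPath ∧ q.length = n ∧
      ∀ y ∈ q.support, ∃ i ∈ Set.Icc (0 : ℤ) n, x i = y by
    obtain ⟨q, h1, h2, -⟩ := h
    exact ⟨q, h1, h2⟩
  induction n with
  | zero => exact ⟨Walk.nil, by simp, by simp, fun y hy => ⟨0, by simp, by simp at hy; simp [hy]⟩⟩
  | succ n ih =>
    obtain ⟨q, hq, hql, hqs⟩ := ih (hinj.mono (Set.Icc_subset_Icc_right (by simp)))
    have h : H.Adj (x n) (x (n + 1 : ℕ)) := by simpa using hadj n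
    refine ⟨q.concat h, hq.concat ?_ _, by simp [hql], ?_⟩
    · intro hmem
      obtain ⟨i, hi, e⟩ := hqs _ hmem
      rw [Set.mem_Icc] at hi
      have := hinj ⟨hi.1, by push_cast; omega⟩ ⟨by omega, le_rfl⟩ e
      push_cast at this
      omega
    · intro y hy
      simp only [Walk.support_concat, List.mem_append,
          List.mem_singleton] at hy
      rcases hy with hy | rfl
      · obtain ⟨i, hi, e⟩ := hqs _ hy
        rw [Set.mem_Icc] at hi
        exact ⟨i, ⟨hi.1, by push_cast; omega⟩, e⟩
      · exact ⟨_, ⟨by omega, le_rfl⟩, rfl⟩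

/-- `S` is the vertex set of an odd cycle of length at most `2 * k - 5`. -/
def IsShortOddCycleSet (G : SimpleGraph V) (k : ℕ) (S : Finset V) : Prop :=
  ∃ j, j + 3 ≤ k ∧ ∃ a b, G.Adj a b ∧ ∃ p : G.Walk a b, p.IsPath ∧ p.length = 2 * j ∧
    ∀ y, y ∈ S ↔ y ∈ p.support

lemma IsShortOddCycleSet.card_le {G : SimpleGraph V} {k : ℕ} {S : Finset V}
    (h : G.IsShortOddCycleSet k S) : S.card ≤ 2 * k := by
  classical
  obtain ⟨j, hj, a, b, -, p, -, hpl, hS⟩ := h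
  have : S = p.support.toFinset := by ext; simp [hS]
  rw [this]
  refine p.support.toFinset_card_le.trans ?_
  rw [Walk.length_support]; omega

lemma IsShortOddCycleSet.nonempty {G : SimpleGraph V} {k : ℕ} {S : Finset V}
    (h : G.IsShortOddCycleSet k S) : S.Nonempty := by
  obtain ⟨j, hj, a, b, -, p, -, hpl, hS⟩ := h
  exact ⟨a, (hS a).2 p.start_mem_support⟩

lemma exists_isShortOddCycleSet_disjoint {G : SimpleGraph V} {k : ℕ} {T : Finset V}
    (h : ¬ (G.induce (T : Set V)ᶜ).OddGirthGE (k - 2)) :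
    ∃ S, G.IsShortOddCycleSet k S ∧ Disjoint S T := by
  classical
  have hex : ∃ j v, ∃ w : (G.induce (T : Set V)ᶜ).Walk v v, w.length = 2 * j + 1 := by
    by_contra! hno
    exact h fun v w ⟨j, hj⟩ => absurd hj (hno j v w)
  have hgirth : (G.induce (T : Set V)ᶜ).OddGirthGE (Nat.find hex) := by
    rintro v w ⟨j, hj⟩
    have := Nat.find_min' hex ⟨v, w, hj⟩
    omega
  have hlt : Nat.find hex < k - 2 := by
    by_contra! hle
    exact h (hgirth.mono hle)
  obtain ⟨v, w, hw⟩ := Nat.find_spec hex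
  obtain ⟨x, hper, hadj⟩ := w.exists_periodic hw
  obtain ⟨q, hq, hql⟩ := exists_path_of_adj_succ hadj (2 * Nat.find hex) (by
    intro i hi j hj e
    rw [Set.mem_Icc] at hi hj
    rcases le_total i j with h | h
    · exact hgirth.periodic_injOn hper hadj h (by push_cast at *; omega) e
    · exact (hgirth.periodic_injOn hper hadj h (by push_cast at *; omega) e.symm).symm)
  have hclose := (hadj (2 * Nat.find hex : ℕ)).symm
  rw [show ((2 * Nat.find hex : ℕ) : ℤ) + 1 = 0 + (2 * Nat.find hex + 1) by push_cast; ring,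
    hper] at hclose
  let q' := q.map (Embedding.induce (G := G) (T : Set V)ᶜ).toHom
  refine ⟨q'.support.toFinset, ⟨Nat.find hex, by omega, _, _, hclose, q', ?_, ?_, ?_⟩, ?_⟩
  · exact hq.map (Embedding.induce (G := G) (T : Set V)ᶜ).injective
  · exact (Walk.length_map _ _).trans hql
  · simp
  · rw [Finset.disjoint_left]
    intro y hy hyT
    simp only [q', Walk.support_map, List.mem_toFinset, List.mem_map] at hy
    obtain ⟨z, -, rfl⟩ := hy
    exact z.2 hyT

/-- Either few vertices hit all short odd cycles, or there are many disjoint ones. -/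
lemma exists_hitting_or_disjoint_family (G : SimpleGraph V) (k t : ℕ) :
    (∃ T : Finset V, T.card ≤ t * (2 * k) ∧ (G.induce (T : Set V)ᶜ).OddGirthGE (k - 2)) ∨
      ∃ F : Finset (Finset V), F.card = t ∧ (∀ S ∈ F, G.IsShortOddCycleSet k S) ∧
        ∀ S ∈ F, ∀ S' ∈ F, S ≠ S' → Disjoint S S' := by
  classical
  induction t with
  | zero => exact .inr ⟨∅, by simp⟩
  | succ t ih =>
    rcases ih with ⟨T, hT, h⟩ | ⟨F, hF, hFS, hFd⟩
    · exact .inl ⟨T, hT.trans (by gcongr; omega), h⟩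
    by_cases h : (G.induce ((F.biUnion id : Finset V) : Set V)ᶜ).OddGirthGE (k - 2)
    · refine .inl ⟨_, ?_, h⟩
      refine (Finset.card_biUnion_le_card_mul _ _ (2 * k) fun S hS => (hFS S hS).card_le).trans ?_
      gcongr; omega
    · obtain ⟨S, hS, hSd⟩ := exists_isShortOddCycleSet_disjoint h
      rw [Finset.disjoint_biUnion_right] at hSd
      have hSF : S ∉ F := fun hmem => hS.nonempty.ne_empty (disjoint_self.1 (hSd S hmem))
      refine .inr ⟨insert S F, by rw [Finset.card_insert_of_notMem hSF, hF], ?_, ?_⟩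
      · intro S' hS'
        rcases Finset.mem_insert.1 hS' with rfl | h'
        exacts [hS, hFS _ h']
      · intro S₁ h1 S₂ h2 hne
        rcases Finset.mem_insert.1 h1 with e1 | h1 <;> rcases Finset.mem_insert.1 h2 with e2 | h2
        · exact absurd (e1.trans e2.symm) hne
        · exact e1 ▸ hSd _ h2
        · exact e2 ▸ (hSd _ h1).symm
        · exact hFd _ h1 _ h2 hne

/-- In a graph of linear minimum degree without cycles of length `2 * k - 1`, boundedly many
vertices hit all odd cycles of length at most `2 * k - 5`. -/
lemma exists_hitting_short_odd_cycles (k : ℕ) (hk : 1 ≤ k) :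
    ∃ C n₀ : ℕ, ∀ (V : Type) [Fintype V], n₀ ≤ Nat.card V →
      ∀ G : SimpleGraph V, ¬ HasCycleOfLength G (2 * k - 1) →
        (∀ v, Nat.card V ≤ 2 * k * (G.neighborSet v).ncard) →
        ∃ T : Finset V, T.card ≤ C ∧ (G.induce (T : Set V)ᶜ).OddGirthGE (k - 2) := by
  classical
  let N := k * (4 * k * (4 * k * k))
  let q := 4 * k + N + 1
  refine ⟨N * (2 * k), 4 * k * (2 ^ N * q) + 1, ?_⟩
  intro V _ hn G hG hdeg
  rcases G.exists_hitting_or_disjoint_family k N with h | ⟨F, hF, hFS, hFd⟩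
  · exact h
  exfalso
  apply hG
  have : Nonempty V := by
    by_contra hV
    rw [not_nonempty_iff] at hV
    simp at hn
  choose! j hj a b hab hp using hFS
  obtain ⟨j₀, hj₀, hcard⟩ := Finset.exists_le_card_fiber_of_mul_le_card_of_maps_to
    (s := F) (t := Finset.range k) (f := j) (n := 4 * k * (4 * k * k))
    (fun S hS => by have := hj S hS; simp; omega) (by simp; omega) (by simp [hF, N])
  set I := F.filter fun S => j S = j₀ with hI
  have hIF : I ⊆ F := Finset.filter_subset _ _
  have hbound : ∀ A ⊆ F, 4 * k * (2 ^ A.card * q) < Nat.card V := by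
    intro A hA
    refine lt_of_le_of_lt ?_ hn
    have : A.card ≤ N := hF ▸ Finset.card_le_card hA
    gcongr
    norm_num
  obtain ⟨A₁, hA₁, hc₁, Wa, hWa, hWa'⟩ :=
    G.exists_subset_card_commonNeighbors I a hk hdeg (hbound I hIF)
  obtain ⟨A, hA, hc, Wb, hWb, hWb'⟩ :=
    G.exists_subset_card_commonNeighbors A₁ b hk hdeg (hbound A₁ (hA₁.trans hIF))
  have hAF : A ⊆ F := (hA.trans hA₁).trans hIF
  have hAcard : k ≤ A.card := by
    have h1 : 4 * k * k ≤ A₁.card :=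
      Nat.le_of_mul_le_mul_left (hcard.trans hc₁) (by omega)
    exact Nat.le_of_mul_le_mul_left (h1.trans hc) (by omega)
  have hAN : A.card ≤ N := hF ▸ Finset.card_le_card hAF
  have hjA : ∀ S ∈ A, j S = j₀ := fun S hS => (Finset.mem_filter.1 (hA₁ (hA hS))).2
  obtain ⟨S₀, hS₀⟩ := Finset.card_pos.1 (by omega : 0 < A.card)
  have hj₀k : j₀ + 3 ≤ k := hjA S₀ hS₀ ▸ hj S₀ (hAF hS₀)
  have := hasCycleOfLength_of_disjoint_cycles (G := G) A a b id (j := j₀) (m := k - 1 - j₀)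
    (by omega) (by omega) (fun S hS S' hS' => hFd S (hAF hS) S' (hAF hS'))
    (fun S hS => by
      obtain ⟨p, h1, h2, h3⟩ := hp S (hAF hS)
      exact ⟨p, h1, by rw [h2, hjA S hS], fun y => (h3 y).2⟩)
    (fun S hS => hab S (hAF hS)) Wa Wb (fun w hw S hS => hWa' w hw S (hA hS)) hWb'
    (by omega) (by omega)
  rwa [show 2 * j₀ + 1 + 2 * (k - 1 - j₀) = 2 * k - 1 by omega] at this

end SimpleGraph

/-- Corollary 5.2: for `k ≥ 5535` and `ε > 0` there are `C` and `n₀` such that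
every `n`-vertex (`n ≥ n₀`) maximal `C_{2k−1}`-free graph with minimum degree at
least `(1/(2k−1) + ε)·n` contains a set `T` of at most `C` vertices whose removal
leaves a graph with chromatic number at most `3`. -/
theorem remove_few_vertices_three_colorable (k : ℕ) (hk : 5535 ≤ k)
    (ε : ℝ) (hε : 0 < ε) :
    ∃ C n₀ : ℕ, ∀ (V : Type) [Fintype V], n₀ ≤ Nat.card V →
      ∀ G : SimpleGraph V, MaximalCLFree G (2 * k - 1) →
        (∀ v : V,
          ((1 : ℝ) / (2 * (k : ℝ) - 1) + ε) * (Nat.card V) ≤ (G.neighborSet v).ncard) →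
        ∃ T : Finset V, T.card ≤ C ∧
          (G.induce ((↑T : Set V)ᶜ)).chromaticNumber ≤ 3 := by
  obtain ⟨C, n₁, h⟩ := SimpleGraph.exists_hitting_short_odd_cycles k (by omega)
  refine ⟨C, max n₁ (⌊(C : ℝ) / ε⌋₊ + 1), fun V _ hn G hG hdeg => ?_⟩
  have hnC : (C : ℝ) < ε * Nat.card V := by
    have h1 : ⌊(C : ℝ) / ε⌋₊ < Nat.card V := (le_max_right _ _).trans hn
    rw [← div_lt_iff₀' hε]
    exact (Nat.floor_lt (by positivity)).1 h1
  have hk' : (0 : ℝ) < 2 * k - 1 := by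
    have : (5535 : ℝ) ≤ k := by exact_mod_cast hk
    linarith
  have hdegC : ∀ v, Nat.card V + (2 * k - 1) * C < (2 * k - 1) * (G.neighborSet v).ncard := by
    intro v
    have h1 := mul_le_mul_of_nonneg_left (hdeg v) hk'.le
    have h2 : (2 * (k : ℝ) - 1) * ((1 / (2 * (k : ℝ) - 1) + ε) * Nat.card V) =
        Nat.card V + (2 * (k : ℝ) - 1) * (ε * Nat.card V) := by
      field_simp
    have h3 := mul_lt_mul_of_pos_left hnC hk'
    have h4 : ((Nat.card V + (2 * k - 1) * C : ℕ) : ℝ) <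
        ((2 * k - 1) * (G.neighborSet v).ncard : ℕ) := by
      push_cast [Nat.cast_sub (show 1 ≤ 2 * k by omega)]
      linarith
    exact_mod_cast h4
  obtain ⟨T, hTC, hT⟩ := h V ((le_max_left _ _).trans hn) G hG.1 fun v => by
    have h1 := hdegC v
    have h2 : (2 * k - 1) * (G.neighborSet v).ncard ≤ 2 * k * (G.neighborSet v).ncard := by
      gcongr; omega
    omega
  refine ⟨T, hTC, chromaticNumber_le_iff_colorable.2 ?_⟩
  refine hT.colorable_three (by omega) fun Y hY => ?_
  classical
  have h1 := hY.card_mul_le (d := Nat.card V / (2 * k - 1) + 1) fun v => by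
    refine Nat.div_lt_of_lt_mul ?_
    have h2 := hdegC v
    have h3 := Nat.mul_le_mul_left (2 * k - 1) (G.ncard_neighborSet_le_induce_compl T v)
    have h4 := Nat.mul_le_mul_left (2 * k - 1) hTC
    rw [mul_add] at h3
    omega
  have h2 := Nat.lt_mul_div_succ (Nat.card V) (show 0 < 2 * k - 1 by omega)
  have h3 : Nat.card ((T : Set V)ᶜ : Set V) ≤ Nat.card V := Finite.card_subtype_le _
  have h4 : Y.card * (Nat.card V / (2 * k - 1) + 1) <
      (2 * (2 * k - 1)) * (Nat.card V / (2 * k - 1) + 1) := by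
    rw [mul_assoc]; omega
  have h5 := Nat.lt_of_mul_lt_mul_right h4
  omega
end

section
/- Claim 4.6 (large set with pairwise many common neighbors): For every integer k ≥ 2 and every ε > 0, there exists n_0 such that the following holds for all n ≥ n_0. Let G be an n-vertex graph with minimum degree δ(G) ≥ (1/(2k−1) + ε)·n. Then for every subset U ⊆ V(G) with |U| = K > (2k−1)^{2k−1}, there exists a subset U' ⊆ U with |U'| ≥ K^{1/(2k−1)} such that any two distinct vertices of U' have at least 5k common neighbors in G. -/
open SimpleGraph

open Finset in
/-- A Ramsey bound: if all `r`-cliques in `U` have at most `s` elements and all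
`r`-independent sets in `U` have at most `j` elements, then `U` has fewer than `s ^ (j + 1)`
elements. -/
theorem card_add_two_le_pow_of_clique_of_indep {α : Type*} [DecidableEq α] {r : α → α → Prop}
    [Std.Symm r] {s : ℕ} (hs : 2 ≤ s) (j : ℕ) (U : Finset α)
    (hC : ∀ C ⊆ U, (C : Set α).Pairwise r → #C ≤ s)
    (hI : ∀ I ⊆ U, (I : Set α).Pairwise (fun u v => ¬ r u v) → #I ≤ j) :
    #U + 2 ≤ s ^ (j + 1) := by
  classical
  have : Std.Symm fun u v => ¬ r u v := ⟨fun _ _ h h' => h (symm h')⟩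
  induction j generalizing U with
  | zero =>
    rcases U.eq_empty_or_nonempty with rfl | ⟨x, hx⟩
    · simpa using hs
    · have := hI {x} (by simpa using hx) (by simp)
      simp at this
  | succ j ih =>
    obtain ⟨C, hCmem, hCmax⟩ := exists_max_image
      (U.powerset.filter fun C : Finset α => (C : Set α).Pairwise r) card ⟨∅, by simp⟩
    simp only [mem_filter, mem_powerset] at hCmem hCmax
    obtain ⟨hCU, hCr⟩ := hCmem
    set F : α → Finset α := fun v => U.filter fun u => u ≠ v ∧ ¬ r v u with hF
    have hcover : U ⊆ C.biUnion fun v => insert v (F v) := by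
      intro u hu
      by_contra hcon
      simp only [mem_biUnion, mem_insert, hF, mem_filter, not_exists, not_and, not_or,
        not_not] at hcon
      have huC : u ∉ C := fun h => (hcon u h).1 rfl
      have hle := hCmax (insert u C) ⟨insert_subset hu hCU, by
        rw [coe_insert]
        refine hCr.insert_of_symm fun v hv hne => symm ?_
        exact (hcon v hv).2 hu hne⟩
      rw [card_insert_of_notMem huC] at hle
      omega
    have hFcard : ∀ v ∈ C, #(insert v (F v)) ≤ s ^ (j + 1) - 1 := by
      intro v hv
      have := ih (F v) (fun D hD => hC D (hD.trans (filter_subset _ _))) (by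
        intro I hIF hIr
        have hvI : v ∉ I := fun h => by simpa [hF] using hIF h
        have hle := hI (insert v I)
          (insert_subset (hCU hv) (hIF.trans (filter_subset _ _))) (by
            rw [coe_insert]
            refine hIr.insert_of_symm fun u hu _ => ?_
            exact (mem_filter.1 (hIF hu)).2.2)
        rw [card_insert_of_notMem hvI] at hle
        omega)
      have := card_insert_le v (F v)
      omega
    have hU := (card_le_card hcover).trans (card_biUnion_le_card_mul _ _ _ hFcard)
    have hU' := hU.trans (Nat.mul_le_mul_right _ (hC C hCU hCr))
    have hpow : 1 ≤ s ^ (j + 1) := Nat.one_le_pow _ _ (by omega)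
    rw [Nat.mul_sub, mul_one, ← pow_succ'] at hU'
    have : s ≤ s ^ (j + 1 + 1) := Nat.le_self_pow (by omega) s
    omega

open Finset in
/-- A union bound: finite sets whose pairwise intersections have at most `c` elements nearly
have disjoint union. -/
theorem sum_card_le_card_biUnion_add {ι α : Type*} [DecidableEq ι] [DecidableEq α]
    (N : ι → Finset α) (c : ℕ) (S : Finset ι)
    (h : (S : Set ι).Pairwise fun u v => #(N u ∩ N v) ≤ c) :
    ∑ v ∈ S, #(N v) ≤ #(S.biUnion N) + c * #S ^ 2 := by
  induction S using Finset.induction_on with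
  | empty => simp
  | insert a S ha ih =>
    rw [coe_insert] at h
    have ih := ih (h.mono (Set.subset_insert _ _))
    have hinter : #(N a ∩ S.biUnion N) ≤ #S * c := by
      rw [inter_biUnion]
      refine card_biUnion_le_card_mul _ _ _ fun v hv => ?_
      exact h (Set.mem_insert _ _) (Set.mem_insert_of_mem _ hv) (by rintro rfl; exact ha hv)
    have hunion := card_union_add_card_inter (N a) (S.biUnion N)
    rw [sum_insert ha, biUnion_insert, card_insert_of_notMem ha]
    nlinarith

/-- Claim 4.6: for `k ≥ 2` and `ε > 0`, for every sufficiently large `n`-vertex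
graph `G` with minimum degree at least `(1/(2k−1) + ε)·n` and every vertex subset
`U` with `|U| = K > (2k−1)^{2k−1}`, there is `U' ⊆ U` with `|U'| ≥ K^{1/(2k−1)}`
such that any two distinct vertices of `U'` have at least `5k` common neighbors. -/
theorem pairwise_many_common_neighbors (k : ℕ) (hk : 2 ≤ k) (ε : ℝ) (hε : 0 < ε) :
    ∃ n₀ : ℕ, ∀ (V : Type) [Fintype V] [DecidableEq V], n₀ ≤ Nat.card V →
      ∀ G : SimpleGraph V,
        (∀ v : V,
          ((1 : ℝ) / (2 * (k : ℝ) - 1) + ε) * (Nat.card V) ≤ (G.neighborSet v).ncard) →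
        ∀ U : Finset V, (2 * k - 1) ^ (2 * k - 1) < U.card →
          ∃ U' ⊆ U, ((U.card : ℝ) ^ ((1 : ℝ) / (2 * (k : ℝ) - 1)) ≤ U'.card ∧
            ∀ u ∈ U', ∀ v ∈ U', u ≠ v →
              5 * k ≤ (G.neighborSet u ∩ G.neighborSet v).ncard) := by
  classical
  obtain ⟨m, hm⟩ : ∃ m, m + 1 = 2 * k - 1 := ⟨2 * k - 2, by omega⟩
  have hmR : (2 * (k : ℝ) - 1) = ((m + 1 : ℕ) : ℝ) := by
    rw [hm, Nat.cast_sub (by omega)]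
    push_cast
    ring
  have hpos : (0 : ℝ) < ((m + 1 : ℕ) : ℝ) := by positivity
  rw [hmR, ← hm]
  refine ⟨⌊5 * k * ((m + 1 : ℕ) : ℝ) / ε⌋₊ + 1, fun V _ _ hn G hdeg U hU => ?_⟩
  set r : V → V → Prop := fun u v => 5 * k ≤ (G.neighborSet u ∩ G.neighborSet v).ncard with hr
  have : Std.Symm r := ⟨fun u v h => by
    simpa only [hr, Set.inter_comm] using h⟩
  have hindep : ∀ I ⊆ U, (I : Set V).Pairwise (fun u v => ¬ r u v) → I.card ≤ m := by
    intro I _ hI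
    by_contra! hlt
    obtain ⟨S, hSI, hS⟩ := Finset.exists_subset_card_eq (show m + 1 ≤ I.card from hlt)
    have hsum := sum_card_le_card_biUnion_add (fun v => G.neighborFinset v) (5 * k) S (by
      intro u hu v hv huv
      have := hI (hSI hu) (hSI hv) huv
      simp only [hr, not_le] at this
      rw [← Set.ncard_coe_finset]
      simpa using this.le)
    have hunion := Finset.card_le_univ (S.biUnion fun v => G.neighborFinset v)
    rw [← Nat.card_eq_fintype_card] at hunion
    have hsum' : ((∑ v ∈ S, (G.neighborFinset v).card : ℕ) : ℝ)
        ≤ Nat.card V + 5 * k * ((m + 1 : ℕ) : ℝ) ^ 2 := by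
      rw [hS] at hsum
      exact_mod_cast hsum.trans (Nat.add_le_add_right hunion _)
    have hlow : ((m + 1 : ℕ) : ℝ) * (((1 : ℝ) / (m + 1 : ℕ) + ε) * Nat.card V)
        ≤ ((∑ v ∈ S, (G.neighborFinset v).card : ℕ) : ℝ) := by
      rw [Nat.cast_sum, ← hS, ← nsmul_eq_mul]
      refine Finset.card_nsmul_le_sum _ _ _ fun v _ => ?_
      rw [hS]
      refine (hdeg v).trans_eq ?_
      rw [← Set.ncard_coe_finset, coe_neighborFinset]
    have hbig : 5 * k * ((m + 1 : ℕ) : ℝ) < Nat.card V * ε := by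
      rw [← div_lt_iff₀ hε]
      exact (Nat.floor_lt (by positivity)).1 hn
    have hexp : ((m + 1 : ℕ) : ℝ) * (((1 : ℝ) / (m + 1 : ℕ) + ε) * Nat.card V)
        = Nat.card V + ((m + 1 : ℕ) : ℝ) * (Nat.card V * ε) := by
      field_simp
    have := mul_lt_mul_of_pos_left hbig hpos
    nlinarith
  set x : ℝ := (U.card : ℝ) ^ ((1 : ℝ) / (m + 1 : ℕ)) with hx
  have hxpow : x ^ (m + 1) = U.card := by
    rw [hx, one_div, Real.rpow_inv_natCast_pow (by positivity) (by omega)]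
  have hx0 : 0 ≤ x := by positivity
  have hmx : ((m + 1 : ℕ) : ℝ) < x := by
    refine lt_of_pow_lt_pow_left₀ (m + 1) hx0 ?_
    rw [hxpow]
    exact_mod_cast hU
  obtain ⟨s, hs⟩ : ∃ s, s + 1 = ⌈x⌉₊ :=
    ⟨⌈x⌉₊ - 1, by have := Nat.ceil_pos.2 (hpos.trans hmx); omega⟩
  have hsx : (s : ℝ) < x := Nat.lt_ceil.1 (by omega)
  have hms : m + 1 < ⌈x⌉₊ := Nat.lt_ceil.2 hmx
  have hsU : s ^ (m + 1) < U.card := by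
    have := pow_lt_pow_left₀ hsx (by positivity) (show m + 1 ≠ 0 by omega)
    rw [hxpow] at this
    exact_mod_cast this
  by_contra! hcon
  have := card_add_two_le_pow_of_clique_of_indep (r := r) (show 2 ≤ s by omega) m U
    (fun C hCU hC => by
      by_contra! hlt
      obtain ⟨u, hu, v, hv, huv, hlt'⟩ := hcon C hCU
        ((Nat.le_ceil x).trans (by rw [← hs]; exact_mod_cast hlt))
      exact absurd (hC hu hv huv) (not_le.2 hlt')) hindep
  omega
end

section
/- Proposition 2.3: Let k ≥ 2 be an integer, ε > 0, and let f ≥ 1 be an integer. Let m be an integer satisfying (m−1)/(2km) ≥ 1/(2k) − ε and m > 2k(k−1)f. Let G be the graph with vertex set {v^{(α)}_x : α ∈ {1,…,2k}, x ∈ {1,…,m}^{k−1}} (so |V(G)| = 2k·m^{k−1}) and edges defined by: (i) for each α ∈ {1,…,k}, v^{(2α−1)}_x is adjacent to v^{(2α)}_y if and only if x_1 ≠ y_1; (ii) for each p ∈ {1,…,k−1}, each α ∈ {1,…,2p} and each β ∈ {2p+1, 2p+2}, v^{(α)}_x is adjacent to v^{(β)}_y if and only if p is the maximum integer such that x_i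 = y_i for all i ∈ {1,…,p}; there are no other edges. Then: (1) the minimum degree of G is at least (m−1)·m^{k−2} = ((m−1)/(2km))·|V(G)| ≥ (1/(2k) − ε)·|V(G)|; (2) G is triangle-free; (3) the VC-dimension of G is at most 4k²; (4) if there is a graph homomorphism from G to a graph H with at most f vertices, then H contains a clique on 2k vertices. -/
open SimpleGraph

/-- A set `S` of vertices of a graph `G` is shattered if every subset of `S` is
a trace of a vertex neighborhood on `S`. -/
def Shattered {V : Type*} (G : SimpleGraph V) (S : Set V) : Prop :=
  ∀ S' ⊆ S, ∃ v : V, G.neighborSet v ∩ S = S'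

/-- The (directed) edge rules of Definition 2.2. A vertex is a pair `(α, x)` with
`α ∈ [2k]` (encoded as `Fin (2k)`, so the paper's index is `u.1.val + 1`) and
`x ∈ [m]^{k−1}`.  Rule (i): for odd `α`, `(α, x) ~ (α+1, y)` iff `x₁ ≠ y₁`.
Rule (ii): for `p ∈ [k−1]`, `α ∈ [2p]`, `β ∈ {2p+1, 2p+2}`, `(α, x) ~ (β, y)` iff
`p` is the maximal integer with `xᵢ = yᵢ` for all `i ∈ [p]`. -/
def rel2k (k m : ℕ) (u w : Fin (2 * k) × (Fin (k - 1) → Fin m)) : Prop :=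
  ((u.1.val + 1) % 2 = 1 ∧ w.1.val = u.1.val + 1 ∧
    ∃ i : Fin (k - 1), (i : ℕ) = 0 ∧ u.2 i ≠ w.2 i) ∨
  (∃ p : ℕ, 1 ≤ p ∧ p ≤ k - 1 ∧ u.1.val + 1 ≤ 2 * p ∧
    (w.1.val + 1 = 2 * p + 1 ∨ w.1.val + 1 = 2 * p + 2) ∧
    (∀ i : Fin (k - 1), (i : ℕ) + 1 ≤ p → u.2 i = w.2 i) ∧
    (∀ i : Fin (k - 1), (i : ℕ) + 1 = p + 1 → u.2 i ≠ w.2 i))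

/-- The `2k`-partite triangle-free graph of Definition 2.2 on `2k·m^{k−1}` vertices. -/
def G2k (k m : ℕ) : SimpleGraph (Fin (2 * k) × (Fin (k - 1) → Fin m)) :=
  SimpleGraph.fromRel (rel2k k m)

/-- The words `x` and `y` agree on their first `p` letters. -/
def AgreeBelow {n m : ℕ} (p : ℕ) (x y : Fin n → Fin m) : Prop :=
  ∀ i : Fin n, (i : ℕ) < p → x i = y i

/-- The words `x` and `y` agree on exactly their first `p` letters. -/
def AgreeExactly {n m : ℕ} (p : ℕ) (x y : Fin n → Fin m) : Prop :=
  AgreeBelow p x y ∧ ∀ i : Fin n, (i : ℕ) = p → x i ≠ y i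

namespace AgreeBelow

variable {n m p q : ℕ} {x y z : Fin n → Fin m}

lemma symm (h : AgreeBelow p x y) : AgreeBelow p y x := fun i hi => (h i hi).symm

lemma trans (h : AgreeBelow p x y) (h' : AgreeBelow p y z) : AgreeBelow p x z :=
  fun i hi => (h i hi).trans (h' i hi)

lemma mono (hpq : p ≤ q) (h : AgreeBelow q x y) : AgreeBelow p x y :=
  fun i hi => h i (hi.trans_le hpq)

lemma eq_of_le (hp : n ≤ p) (h : AgreeBelow p x y) : x = y :=
  funext fun i => h i (i.isLt.trans_le hp)

end AgreeBelow

lemma AgreeExactly.symm {n m p : ℕ} {x y : Fin n → Fin m} (h : AgreeExactly p x y) :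
    AgreeExactly p y x :=
  ⟨h.1.symm, fun i hi => (h.2 i hi).symm⟩

lemma agreeExactly_iff {n m p : ℕ} (hp : p < n) {x y : Fin n → Fin m} :
    AgreeExactly p x y ↔ AgreeBelow p x y ∧ ¬ AgreeBelow (p + 1) x y := by
  refine and_congr_right fun h => ⟨fun h' h'' => h' ⟨p, hp⟩ rfl (h'' _ (Nat.lt_succ_self p)), ?_⟩
  rintro h' i rfl he
  refine h' fun j hj => ?_
  rcases Nat.lt_succ_iff_lt_or_eq.mp hj with hj | hj
  · exact h j hj
  · rwa [Fin.ext hj]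

/-- The prefix length governing adjacency between the parts `a` and `b`. -/
def prefixLength (a b : ℕ) : ℕ := if a / 2 = b / 2 then 0 else max (a / 2) (b / 2)

lemma prefixLength_comm (a b : ℕ) : prefixLength a b = prefixLength b a := by
  simp only [prefixLength, eq_comm, max_comm]

lemma rel2k_iff {k m : ℕ} (hk : 2 ≤ k) (u w : Fin (2 * k) × (Fin (k - 1) → Fin m)) :
    rel2k k m u w ↔
      u.1.val < w.1.val ∧ AgreeExactly (prefixLength u.1 w.1) u.2 w.2 := by
  obtain ⟨⟨a, ha⟩, x⟩ := u
  obtain ⟨⟨b, hb⟩, y⟩ := w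
  simp only [rel2k, prefixLength]
  constructor
  · rintro (⟨h1, h2, i, hi, hne⟩ | ⟨p, hp1, hp2, h1, h2, h3, h4⟩)
    · rw [if_pos (by omega)]
      refine ⟨by omega, fun j hj => absurd hj (by omega), fun j hj => ?_⟩
      rwa [show j = i from Fin.ext (by omega)]
    · rw [if_neg (by omega), show max (a / 2) (b / 2) = p by omega]
      exact ⟨by omega, fun j hj => h3 j (by omega), fun j hj => h4 j (by omega)⟩
  · rintro ⟨hab, h⟩
    split_ifs at h with hl
    · exact Or.inl ⟨by omega, by omega, ⟨0, by omega⟩, rfl, h.2 _ rfl⟩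
    · rw [show max (a / 2) (b / 2) = b / 2 by omega] at h
      exact Or.inr ⟨b / 2, by omega, by omega, by omega, by omega,
        fun j hj => h.1 j (by omega), fun j hj => h.2 j (by omega)⟩

lemma G2k_adj_iff {k m : ℕ} (hk : 2 ≤ k) (u w : Fin (2 * k) × (Fin (k - 1) → Fin m)) :
    (G2k k m).Adj u w ↔
      u.1 ≠ w.1 ∧ AgreeExactly (prefixLength u.1 w.1) u.2 w.2 := by
  rw [G2k, fromRel_adj, rel2k_iff hk, rel2k_iff hk, prefixLength_comm w.1 u.1]
  constructor
  · rintro ⟨-, h | h⟩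
    · exact ⟨fun e => h.1.ne (congrArg _ e), h.2⟩
    · exact ⟨fun e => h.1.ne (congrArg _ e.symm), h.2.symm⟩
  · rintro ⟨hne, h⟩
    refine ⟨fun e => hne (congrArg _ e), ?_⟩
    rcases lt_or_gt_of_ne (Fin.val_ne_of_ne hne) with hlt | hlt
    · exact Or.inl ⟨hlt, h⟩
    · exact Or.inr ⟨hlt, h.symm⟩

lemma AgreeExactly.false_of_agreeBelow {n m p q : ℕ} {x y z : Fin n → Fin m}
    (h : AgreeExactly p x y) (hpq : p < q) (hpn : p < n)
    (hx : AgreeBelow q x z) (hy : AgreeBelow q y z) : False :=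
  ((agreeExactly_iff hpn).mp h).2 ((hx.trans hy.symm).mono hpq)

lemma G2k_cliqueFree_three {k m : ℕ} (hk : 2 ≤ k) : (G2k k m).CliqueFree 3 := by
  intro s hs
  obtain ⟨⟨a, x⟩, ⟨b, y⟩, ⟨c, z⟩, hab, hac, hbc, -⟩ := is3Clique_iff.mp hs
  rw [G2k_adj_iff hk] at hab hac hbc
  obtain ⟨nab, hab⟩ := hab
  obtain ⟨nac, hac⟩ := hac
  obtain ⟨nbc, hbc⟩ := hbc
  simp only [ne_eq, Fin.ext_iff] at nab nac nbc hab hac hbc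
  have ha := a.isLt
  have hb := b.isLt
  have hc := c.isLt
  have key :
      (prefixLength a b < prefixLength a c ∧ prefixLength a c = prefixLength b c ∧
        prefixLength a b < k - 1) ∨
      (prefixLength a c < prefixLength a b ∧ prefixLength a b = prefixLength b c ∧
        prefixLength a c < k - 1) ∨
      (prefixLength b c < prefixLength a b ∧ prefixLength a b = prefixLength a c ∧
        prefixLength b c < k - 1) := by
    unfold prefixLength
    split_ifs <;> omega
  rcases key with ⟨h1, h2, h3⟩ | ⟨h1, h2, h3⟩ | ⟨h1, h2, h3⟩
  · exact hab.false_of_agreeBelow h1 h3 hac.1 (h2 ▸ hbc.1)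
  · exact hac.false_of_agreeBelow h1 h3 hab.1 (h2 ▸ hbc.1.symm)
  · exact hbc.false_of_agreeBelow h1 h3 hab.1.symm (h2 ▸ hac.1.symm)

/-- The pairs in a set of at least four words cannot all be cut out by the spheres
`{x | AgreeExactly p y x}`. -/
lemma card_le_three_of_pairs_spherical {n m : ℕ} (T : Finset (Fin n → Fin m))
    (hT : ∀ P ⊆ T, P.card = 2 → ∃ p y, ∀ x ∈ T, x ∈ P ↔ AgreeExactly p y x) :
    T.card ≤ 3 := by
  classical
  by_contra! hcard
  have : Nonempty (Fin n → Fin m) :=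
    let ⟨x, _⟩ := Finset.card_pos.mp (by omega : 0 < T.card); ⟨x⟩
  have hT' : ∀ P ∈ T.powersetCard 2, ∃ p, p < n ∧ ∃ y, ∀ x ∈ T,
      x ∈ P ↔ AgreeBelow p y x ∧ ¬ AgreeBelow (p + 1) y x := by
    intro P hP
    obtain ⟨hPT, hP2⟩ := Finset.mem_powersetCard.mp hP
    obtain ⟨p, y, h⟩ := hT P hPT hP2
    have hp : p < n := by
      by_contra! hp
      obtain ⟨a, b, hab, rfl⟩ := Finset.card_eq_two.mp hP2
      have ha := (h a (hPT (by simp))).mp (by simp)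
      have hb := (h b (hPT (by simp))).mp (by simp)
      exact hab ((ha.1.eq_of_le hp).symm.trans (hb.1.eq_of_le hp))
    exact ⟨p, hp, y, fun x hx => (h x hx).trans (agreeExactly_iff hp)⟩
  choose! p _ y h using hT'
  obtain ⟨P, hP, hmin⟩ := Finset.exists_min_image (T.powersetCard 2) p
    (Finset.powersetCard_nonempty.mpr (by omega))
  have hagree : ∀ u ∈ T, ∀ v ∈ T, u ≠ v → AgreeBelow (p P) u v := by
    intro u hu v hv huv
    have hQ : ({u, v} : Finset _) ∈ T.powersetCard 2 := Finset.mem_powersetCard.mpr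
      ⟨by simp [Finset.insert_subset_iff, hu, hv], Finset.card_pair huv⟩
    have hu' := (h _ hQ u hu).mp (by simp)
    have hv' := (h _ hQ v hv).mp (by simp)
    exact (hu'.1.symm.trans hv'.1).mono (hmin _ hQ)
  have houtside : ∀ Q ∈ T.powersetCard 2, p Q = p P → ∀ v ∈ T, v ∉ Q →
      AgreeBelow (p P + 1) (y Q) v := by
    intro Q hQ hpQ v hv hvQ
    obtain ⟨hQT, hQ2⟩ := Finset.mem_powersetCard.mp hQ
    obtain ⟨u, hu⟩ := Finset.card_pos.mp (by omega : 0 < Q.card)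
    have hu' := (h Q hQ u (hQT hu)).mp hu
    have hv' := mt (h Q hQ v hv).mpr hvQ
    rw [hpQ] at hu' hv'
    by_contra hcon
    exact hv' ⟨hu'.1.trans (hagree u (hQT hu) v hv fun e => hvQ (e ▸ hu)), hcon⟩
  obtain ⟨hPT, hP2⟩ := Finset.mem_powersetCard.mp hP
  obtain ⟨c, hc, d, hd, hcd⟩ := Finset.one_lt_card.mp
    (by rw [Finset.card_sdiff_of_subset hPT]; omega : 1 < (T \ P).card)
  obtain ⟨hcT, hcP⟩ := Finset.mem_sdiff.mp hc
  obtain ⟨hdT, hdP⟩ := Finset.mem_sdiff.mp hd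
  obtain ⟨a, b, hab, rfl⟩ := Finset.card_eq_two.mp hP2
  have haT : a ∈ T := hPT (by simp)
  have hbT : b ∈ T := hPT (by simp)
  have hac : a ≠ c := fun e => hcP (by simp [e])
  have had : a ≠ d := fun e => hdP (by simp [e])
  have hbc : b ≠ c := fun e => hcP (by simp [e])
  have hbd : b ≠ d := fun e => hdP (by simp [e])
  have ha := (h _ hP a haT).mp (by simp)
  have hb := (h _ hP b hbT).mp (by simp)
  have hyc := houtside _ hP rfl c hcT hcP
  have hyd := houtside _ hP rfl d hdT hdP
  have hQ : ({a, c} : Finset _) ∈ T.powersetCard 2 := Finset.mem_powersetCard.mpr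
    ⟨by simp [Finset.insert_subset_iff, haT, hcT], Finset.card_pair hac⟩
  have hpQ : p {a, c} = p {a, b} := by
    refine le_antisymm ?_ (hmin _ hQ)
    by_contra! hlt
    have ha' := (h _ hQ a haT).mp (by simp)
    have hc' := (h _ hQ c hcT).mp (by simp)
    exact ha.2 (hyc.trans ((hc'.1.symm.trans ha'.1).mono hlt))
  have hb' := houtside _ hQ hpQ b hbT (by simp [hab.symm, hbc])
  have hd' := houtside _ hQ hpQ d hdT (by simp [had.symm, hcd.symm])
  exact hb.2 (hyd.trans (hd'.symm.trans hb'))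

lemma Shattered.ncard_le {k m : ℕ} (hk : 2 ≤ k)
    {S : Set (Fin (2 * k) × (Fin (k - 1) → Fin m))} (hS : Shattered (G2k k m) S) :
    S.ncard ≤ 2 * k * 3 := by
  classical
  by_contra! hcard
  rw [Set.ncard_eq_toFinset_card'] at hcard
  obtain ⟨a, -, ha⟩ := Finset.exists_lt_card_fiber_of_mul_lt_card_of_maps_to
    (s := S.toFinset) (t := Finset.univ) (f := Prod.fst) (n := 3) (by simp) (by simpa using hcard)
  set F := S.toFinset.filter (fun u => u.1 = a) with hF
  have hinj : Set.InjOn Prod.snd (F : Set (Fin (2 * k) × (Fin (k - 1) → Fin m))) := by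
    intro u hu v hv huv
    simp only [hF, Finset.coe_filter, Set.mem_ofPred_eq] at hu hv
    exact Prod.ext (hu.2.trans hv.2.symm) huv
  have hmem : ∀ x, x ∈ F.image Prod.snd ↔ (a, x) ∈ S := by
    intro x
    simp [hF]
  rw [← Finset.card_image_of_injOn hinj] at ha
  refine absurd (card_le_three_of_pairs_spherical (F.image Prod.snd) ?_) ha.not_ge
  intro P hP hP2
  obtain ⟨⟨b, y⟩, hv⟩ := hS ((fun x => (a, x)) '' (P : Set _)) (by
    rintro _ ⟨x, hx, rfl⟩
    exact (hmem x).mp (hP hx))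
  have hadj : ∀ x ∈ F.image Prod.snd, x ∈ P ↔ (G2k k m).Adj (b, y) (a, x) := by
    intro x hx
    have := Set.ext_iff.mp hv (a, x)
    simp only [Set.mem_inter_iff, mem_neighborSet, (hmem x).mp hx, and_true, Set.mem_image,
      Prod.mk.injEq, true_and, exists_eq_right, Finset.mem_coe] at this
    exact this.symm
  obtain ⟨x₀, hx₀⟩ := Finset.card_pos.mp (by omega : 0 < P.card)
  have hba : b ≠ a := ((G2k_adj_iff hk _ _).mp ((hadj x₀ (hP hx₀)).mp hx₀)).1
  refine ⟨prefixLength b a, y, fun x hx => ?_⟩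
  rw [hadj x hx, G2k_adj_iff hk]
  simp [hba]

lemma card_words_ne {n m : ℕ} (i : Fin n) (c : Fin m) :
    (Finset.univ.filter fun y : Fin n → Fin m => y i ≠ c).card = (m - 1) * m ^ (n - 1) := by
  classical
  have : (Finset.univ.filter fun y : Fin n → Fin m => y i ≠ c) =
      Fintype.piFinset (Function.update (fun _ => Finset.univ) i (Finset.univ.erase c)) := by
    ext y
    simp only [Finset.mem_filter, Finset.mem_univ, true_and, Fintype.mem_piFinset]
    constructor
    · intro h j
      rcases eq_or_ne j i with rfl | hj
      · simpa using h
      · simp [hj]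
    · intro h
      simpa using h i
  rw [this, Fintype.card_piFinset, ← Finset.mul_prod_erase _ _ (Finset.mem_univ i),
    Finset.prod_congr rfl (g := fun _ => m)]
  · simp
  · intro j hj
    simp [Finset.ne_of_mem_erase hj]

lemma le_ncard_neighborSet_G2k {k m : ℕ} (hk : 2 ≤ k)
    (v : Fin (2 * k) × (Fin (k - 1) → Fin m)) :
    (m - 1) * m ^ (k - 2) ≤ ((G2k k m).neighborSet v).ncard := by
  classical
  obtain ⟨a, x⟩ := v
  obtain ⟨b, hne, hb⟩ : ∃ b : Fin (2 * k), a ≠ b ∧ a.val / 2 = b.val / 2 := by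
    have := a.isLt
    rcases Nat.mod_two_eq_zero_or_one a.val with h | h
    · exact ⟨⟨a + 1, by omega⟩, by simp [Fin.ext_iff], by simp; omega⟩
    · exact ⟨⟨a - 1, by omega⟩, by simp [Fin.ext_iff]; omega, by simp; omega⟩
  let i : Fin (k - 1) := ⟨0, by omega⟩
  rw [show k - 2 = k - 1 - 1 by omega, ← card_words_ne i (x i),
    ← Finset.card_image_of_injective _ (Prod.mk_right_injective b), ← Set.ncard_coe_finset]
  refine Set.ncard_le_ncard ?_ (Set.toFinite _)
  intro w hw
  obtain ⟨y, hy, rfl⟩ := Finset.mem_image.mp hw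
  rw [mem_neighborSet, G2k_adj_iff hk]
  refine ⟨hne, ?_⟩
  simp only [prefixLength, if_pos hb]
  refine ⟨fun j hj => absurd hj (by omega), fun j hj => ?_⟩
  rw [show j = i from Fin.ext hj]
  exact (Finset.mem_filter.mp hy).2.symm

/-- The words whose colour forces their `p`-th letter, given the earlier letters, are few. -/
lemma card_forced_words_le {n m : ℕ} {W : Type*} [Finite W] (φ : (Fin n → Fin m) → W) (p : Fin n) :
    {x | ∀ y, AgreeBelow p x y → φ x = φ y → x p = y p}.ncard ≤ Nat.card W * m ^ (n - 1) := by
  classical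
  set B := {x | ∀ y, AgreeBelow p x y → φ x = φ y → x p = y p}
  have hinj : Function.Injective
      (fun x : B => (φ x, fun i : {i // i ≠ p} => x.1 i) : B → W × ({i // i ≠ p} → Fin m)) := by
    rintro ⟨x, hx⟩ ⟨y, hy⟩ hxy
    simp only [Prod.mk.injEq] at hxy
    have hne : ∀ i, i ≠ p → x i = y i := fun i hi => congrFun hxy.2 ⟨i, hi⟩
    have hp := hx y (fun i hi => hne i (Fin.ne_of_lt hi)) hxy.1
    refine Subtype.ext (funext fun i => ?_)
    rcases eq_or_ne i p with rfl | hi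
    · exact hp
    · exact hne i hi
  rw [← Nat.card_coe_set_eq]
  refine (Nat.card_le_card_of_injective _ hinj).trans_eq ?_
  simp [Nat.card_prod]

lemma exists_unforced_word {n m : ℕ} {I W : Type*} [Fintype I] [Finite W]
    (φ : I → (Fin n → Fin m) → W) (hn : 0 < n) (hm : Fintype.card I * n * Nat.card W < m) :
    ∃ x, ∀ (a : I) (p : Fin n), ∃ y, AgreeBelow p x y ∧ φ a x = φ a y ∧ x p ≠ y p := by
  classical
  by_contra! hcon
  let B : I × Fin n → Set (Fin n → Fin m) := fun q =>
    {x | ∀ y, AgreeBelow q.2 x y → φ q.1 x = φ q.1 y → x q.2 = y q.2}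
  have hcover : (⋃ q, B q) = Set.univ := by
    refine Set.eq_univ_of_forall fun x => ?_
    obtain ⟨a, p, h⟩ := hcon x
    exact Set.mem_iUnion.mpr ⟨(a, p), h⟩
  have hle : m ^ n ≤ Fintype.card I * n * (Nat.card W * m ^ (n - 1)) := by
    calc m ^ n = (⋃ q, B q).ncard := by simp [hcover, Set.ncard_univ]
      _ ≤ ∑ q, (B q).ncard := by
        simpa using Set.ncard_iUnion_le_of_fintype B
      _ ≤ ∑ _q : I × Fin n, Nat.card W * m ^ (n - 1) :=
        Finset.sum_le_sum fun q _ => card_forced_words_le (φ q.1) q.2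
      _ = _ := by simp
  have hpow : m ^ n = m * m ^ (n - 1) := by rw [← pow_succ', Nat.sub_add_cancel hn]
  have : 0 < m ^ (n - 1) := Nat.pow_pos (by omega)
  rw [hpow, ← mul_assoc] at hle
  exact absurd (Nat.le_of_mul_le_mul_right hle this) hm.not_ge

lemma not_cliqueFree_of_G2k_hom {k m : ℕ} (hk : 2 ≤ k) {W : Type*} [Finite W]
    {H : SimpleGraph W} (hm : 2 * k * (k - 1) * Nat.card W < m) (φ : G2k k m →g H) :
    ¬ H.CliqueFree (2 * k) := by
  obtain ⟨x, hx⟩ := exists_unforced_word (fun (a : Fin (2 * k)) z => φ (a, z))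
    (by omega : 0 < k - 1) (by simpa using hm)
  have hlt : ∀ a b : Fin (2 * k), a < b → H.Adj (φ (a, x)) (φ (b, x)) := by
    intro a b hab
    obtain ⟨y, hy, hφ⟩ : ∃ y, AgreeExactly (prefixLength a b) x y ∧ φ (b, x) = φ (b, y) := by
      by_cases hp : prefixLength a b < k - 1
      · obtain ⟨y, h1, h2, h3⟩ := hx b ⟨prefixLength a b, hp⟩
        refine ⟨y, ⟨h1, fun i hi => ?_⟩, h2⟩
        rwa [show i = ⟨prefixLength a b, hp⟩ from Fin.ext hi]
      · exact ⟨x, ⟨fun _ _ => rfl, fun i hi => absurd i.isLt (by omega)⟩, rfl⟩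
    rw [hφ]
    exact φ.map_adj ((G2k_adj_iff hk _ _).mpr ⟨hab.ne, hy⟩)
  have hadj : ∀ a b : Fin (2 * k), a ≠ b → H.Adj (φ (a, x)) (φ (b, x)) := by
    intro a b hab
    rcases lt_or_gt_of_ne hab with h | h
    · exact hlt a b h
    · exact (hlt b a h).symm
  rw [not_cliqueFree_iff_top_isContained]
  exact ⟨⟨⟨fun a => φ (a, x), fun {a b} h => hadj a b h⟩, fun a b h => by
    by_contra hab
    exact (hadj a b hab).ne h⟩⟩

/-- Proposition 2.3: for `k ≥ 2`, `ε > 0`, `f ≥ 1` and `m` with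
`(m−1)/(2km) ≥ 1/(2k) − ε` and `m > 2k(k−1)f`, the graph `G2k k m` has minimum
degree at least `(m−1)·m^{k−2} = ((m−1)/(2km))·|V| ≥ (1/(2k) − ε)·|V|`, is
triangle-free, has VC-dimension at most `4k²`, and every graph on at most `f`
vertices admitting a homomorphism from it contains a clique on `2k` vertices. -/
theorem even_construction (k : ℕ) (hk : 2 ≤ k) (ε : ℝ) (hε : 0 < ε)
    (f m : ℕ) (hf : 1 ≤ f)
    (hm1 : (1 : ℝ) / (2 * (k : ℝ)) - ε ≤ ((m : ℝ) - 1) / (2 * (k : ℝ) * (m : ℝ)))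
    (hm2 : 2 * k * (k - 1) * f < m) :
    (∀ v, ((m - 1) * m ^ (k - 2) : ℕ) ≤ ((G2k k m).neighborSet v).ncard ∧
      (((m - 1) * m ^ (k - 2) : ℕ) : ℝ) =
        (((m : ℝ) - 1) / (2 * (k : ℝ) * (m : ℝ))) *
          (Nat.card (Fin (2 * k) × (Fin (k - 1) → Fin m))) ∧
      ((1 : ℝ) / (2 * (k : ℝ)) - ε) *
          (Nat.card (Fin (2 * k) × (Fin (k - 1) → Fin m))) ≤
        ((G2k k m).neighborSet v).ncard) ∧
    (G2k k m).CliqueFree 3 ∧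
    (∀ S : Set (Fin (2 * k) × (Fin (k - 1) → Fin m)),
      Shattered (G2k k m) S → S.ncard ≤ 4 * k ^ 2) ∧
    (∀ (W : Type) [Finite W], ∀ H : SimpleGraph W,
      Nat.card W ≤ f → Nonempty (G2k k m →g H) → ¬ H.CliqueFree (2 * k)) := by
  have hm : 0 < m := by omega
  have hcard : (((m - 1) * m ^ (k - 2) : ℕ) : ℝ) =
      (((m : ℝ) - 1) / (2 * (k : ℝ) * (m : ℝ))) *
        (Nat.card (Fin (2 * k) × (Fin (k - 1) → Fin m))) := by
    have hk0 : (k : ℝ) ≠ 0 := by positivity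
    have hm0 : (m : ℝ) ≠ 0 := by positivity
    have hpow : (m : ℝ) ^ (k - 1) = m * m ^ (k - 2) := by
      rw [← pow_succ', show k - 2 + 1 = k - 1 by omega]
    simp only [Nat.card_eq_fintype_card, Fintype.card_prod, Fintype.card_fin, Fintype.card_pi,
      Finset.prod_const, Finset.card_univ]
    push_cast [Nat.cast_sub hm]
    rw [hpow]
    field_simp
  refine ⟨fun v => ?_, G2k_cliqueFree_three hk, fun S hS => ?_, ?_⟩
  · have hdeg := le_ncard_neighborSet_G2k hk v
    refine ⟨hdeg, hcard, ?_⟩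
    calc _ ≤ _ := mul_le_mul_of_nonneg_right hm1 (Nat.cast_nonneg _)
      _ = _ := hcard.symm
      _ ≤ _ := by exact_mod_cast hdeg
  · have := hS.ncard_le hk
    nlinarith
  · rintro W _ H hW ⟨φ⟩
    exact not_cliqueFree_of_G2k_hom hk ((Nat.mul_le_mul_left _ hW).trans_lt hm2) φ
end
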